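/- arXiv:math/0510612 — 2 statements merged into one kernel-verified Lean document; each statement's English description precedes it below -/
import Mathlib

section
/- Theorem (Theorem 1.6): There is an absolute constant c such that for every n × n orthogonal matrix U and every coordinate i, ∫_{ℝⁿ} ζᵢ²(x) dμₙ(x) ≤ c (ln n)²/n, where ζᵢ(x) is the i-th coordinate of Ux − σ(U,x)x and σ(U,x) is the rounding of U at x. -/
open MeasureTheory ProbabilityTheory Matrix

/-- The standard Gaussian probability measure on `ℝⁿ`. -/
noncomputable def stdGaussianMeasure (n : ℕ) : Measure (Fin n → ℝ) :=
  Measure.pi fun _ => gaussianReal 0 1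

/-- The rounding of an orthogonal matrix `U` at a point `x`: the permutation matching
the `k`-th smallest coordinate of `x` with the `k`-th smallest coordinate of `U x`,
i.e. `σ = ψ ∘ φ⁻¹` where `φ` sorts the coordinates of `x` and `ψ` sorts those of `U x`. -/
noncomputable def roundPerm {n : ℕ} (U : Matrix (Fin n) (Fin n) ℝ) (x : Fin n → ℝ) :
    Equiv.Perm (Fin n) :=
  Tuple.sort (U.mulVec x) * (Tuple.sort x)⁻¹

/-- `ζᵢ(x)`: the `i`-th coordinate of `Ux - σ(U,x)x`, where the permutation `σ` acts on a
vector by `(σ · x) i = x (σ⁻¹ i)` (multiplication by the permutation matrix of `σ`). -/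
noncomputable def zeta {n : ℕ} (U : Matrix (Fin n) (Fin n) ℝ) (x : Fin n → ℝ) (i : Fin n) : ℝ :=
  U.mulVec x i - x ((roundPerm U x)⁻¹ i)

/-- The distribution function of the standard Gaussian law. -/
noncomputable abbrev stdCDF (t : ℝ) : ℝ := cdf (gaussianReal 0 1) t

lemma hasDerivAt_stdCDF (t : ℝ) : HasDerivAt stdCDF (gaussianPDFReal 0 1 t) t := by
  have hint := integrable_gaussianPDFReal 0 1
  have hcont : Continuous (gaussianPDFReal 0 1) := by
    unfold gaussianPDFReal
    fun_prop
  have hF : ∀ s, stdCDF s = (∫ v in Set.Iic (0 : ℝ), gaussianPDFReal 0 1 v)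
      + ∫ v in (0 : ℝ)..s, gaussianPDFReal 0 1 v := by
    intro s
    rw [← intervalIntegral.integral_Iic_sub_Iic hint.integrableOn hint.integrableOn,
      add_sub_cancel, stdCDF, cdf_eq_real, Measure.real, gaussianReal_apply_eq_integral 0 one_ne_zero,
      ENNReal.toReal_ofReal]
    exact integral_nonneg fun v => gaussianPDFReal_nonneg 0 1 v
  rw [show stdCDF = fun s => (∫ v in Set.Iic (0 : ℝ), gaussianPDFReal 0 1 v)
      + ∫ v in (0 : ℝ)..s, gaussianPDFReal 0 1 v from funext hF]
  exact (intervalIntegral.integral_hasDerivAt_right hint.intervalIntegrable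
    (hcont.stronglyMeasurableAtFilter _ _) hcont.continuousAt).const_add _

lemma continuous_stdCDF : Continuous stdCDF :=
  continuous_iff_continuousAt.2 fun t => (hasDerivAt_stdCDF t).continuousAt

lemma strictMono_stdCDF : StrictMono stdCDF :=
  strictMono_of_hasDerivAt_pos hasDerivAt_stdCDF
    fun t => gaussianPDFReal_pos 0 1 t one_ne_zero

lemma exists_stdCDF_eq {p : ℝ} (h0 : 0 < p) (h1 : p < 1) : ∃ q, stdCDF q = p := by
  obtain ⟨a, ha⟩ := ((tendsto_cdf_atBot (gaussianReal 0 1)).eventually_lt_const h0).exists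
  obtain ⟨b, hb⟩ := ((tendsto_cdf_atTop (gaussianReal 0 1)).eventually_const_lt h1).exists
  exact mem_range_of_exists_le_of_exists_ge continuous_stdCDF ⟨a, ha.le⟩ ⟨b, hb.le⟩

lemma stdCDF_eq_real (t : ℝ) : stdCDF t = (gaussianReal 0 1).real (Set.Iic t) := cdf_eq_real _ t

lemma stdCDF_pos (t : ℝ) : 0 < stdCDF t :=
  (cdf_nonneg _ (t - 1)).trans_lt (strictMono_stdCDF (sub_one_lt t))

lemma stdCDF_lt_one (t : ℝ) : stdCDF t < 1 :=
  (strictMono_stdCDF (lt_add_one t)).trans_le (cdf_le_one _ (t + 1))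

lemma real_stdCDF_le_le {u : ℝ} (hu : 0 ≤ u) :
    (gaussianReal 0 1).real {t | stdCDF t ≤ u} ≤ u := by
  rcases lt_or_ge u 1 with h1 | h1
  · rcases hu.eq_or_lt with rfl | h0
    · have : {t | stdCDF t ≤ 0} = ∅ := by
        ext t
        simpa using stdCDF_pos t
      simp [this]
    · obtain ⟨q, rfl⟩ := exists_stdCDF_eq h0 h1
      have : {t | stdCDF t ≤ stdCDF q} = Set.Iic q := by
        ext t
        exact strictMono_stdCDF.le_iff_le
      rw [this, stdCDF_eq_real]
  · exact measureReal_le_one.trans h1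

lemma real_one_sub_stdCDF_le_le {u : ℝ} (hu : 0 ≤ u) :
    (gaussianReal 0 1).real {t | 1 - stdCDF t ≤ u} ≤ u := by
  rcases lt_or_ge u 1 with h1 | h1
  · rcases hu.eq_or_lt with rfl | h0
    · have : {t | 1 - stdCDF t ≤ 0} = ∅ := by
        ext t
        simpa using stdCDF_lt_one t
      rw [this, measureReal_empty]
    · obtain ⟨q, hq⟩ := exists_stdCDF_eq (p := 1 - u) (by linarith) (by linarith)
      have : {t | 1 - stdCDF t ≤ u} = Set.Ici q := by
        ext t
        rw [Set.mem_ofPred_eq, Set.mem_Ici, ← strictMono_stdCDF.le_iff_le (a := q), hq]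
        constructor <;> intro h <;> linarith
      have hnull : NullSingletonClass (gaussianReal 0 1) := nullSingletonClass_gaussianReal one_ne_zero
      have h2 : (gaussianReal 0 1).real (Set.Ici q) = (gaussianReal 0 1).real (Set.Ioi q) :=
        measureReal_congr Ioi_ae_eq_Ici.symm
      rw [this, h2, ← Set.compl_Iic, probReal_compl_eq_one_sub measurableSet_Iic,
        ← stdCDF_eq_real, hq]
      linarith
  · exact measureReal_le_one.trans h1

lemma min_stdCDF_le (t : ℝ) :
    min (stdCDF t) (1 - stdCDF t) ≤ √(2 * Real.pi) * gaussianPDFReal 0 1 t := by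
  have hpdf : √(2 * Real.pi) * gaussianPDFReal 0 1 t = Real.exp (-t * t + t ^ 2 / 2) := by
    have : √(2 * Real.pi) ≠ 0 := by positivity
    rw [gaussianPDFReal]
    simp only [NNReal.coe_one, mul_one, sub_zero]
    rw [← mul_assoc, mul_inv_cancel₀ this, one_mul]
    congr 1
    ring
  rw [hpdf, Real.exp_add]
  have hmgf : mgf id (gaussianReal 0 1) t = Real.exp (t ^ 2 / 2) := by
    simp [mgf_id_gaussianReal]
  rw [← hmgf]
  have hi : Integrable (fun v => Real.exp (t * id v)) (gaussianReal 0 1) :=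
    integrable_exp_mul_gaussianReal t
  rcases le_total t 0 with ht | ht
  · refine (min_le_left _ _).trans ?_
    rw [stdCDF_eq_real]
    exact measure_le_le_exp_mul_mgf t ht hi
  · refine (min_le_right _ _).trans ?_
    rw [stdCDF_eq_real, ← probReal_compl_eq_one_sub measurableSet_Iic, Set.compl_Iic]
    refine le_trans (measureReal_mono ?_) (measure_ge_le_exp_mul_mgf t ht hi)
    exact fun v hv => le_of_lt (Set.mem_Ioi.1 hv)

lemma mul_sub_le_stdCDF_sub {s t a : ℝ} (hst : s ≤ t) (hs : a ≤ stdCDF s)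
    (ht : a ≤ 1 - stdCDF t) : a * (t - s) ≤ √(2 * Real.pi) * (stdCDF t - stdCDF s) := by
  have hpos : 0 < √(2 * Real.pi) := by positivity
  have key := Convex.mul_sub_le_image_sub_of_le_deriv (convex_Icc s t)
    continuous_stdCDF.continuousOn
    (fun v _ => (hasDerivAt_stdCDF v).differentiableAt.differentiableWithinAt)
    (C := a / √(2 * Real.pi)) (fun v hv => by
      rw [interior_Icc] at hv
      rw [(hasDerivAt_stdCDF v).deriv, div_le_iff₀' hpos]
      refine le_trans (le_min ?_ ?_) (min_stdCDF_le v)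
      · exact hs.trans (strictMono_stdCDF.monotone hv.1.le)
      · have := strictMono_stdCDF.monotone hv.2.le
        linarith) s (Set.left_mem_Icc.2 hst) t (Set.right_mem_Icc.2 hst) hst
  rw [div_mul_eq_mul_div, div_le_iff₀' hpos] at key
  exact key

lemma integrable_exp_sq_div_four :
    Integrable (fun t : ℝ => Real.exp (t ^ 2 / 4)) (gaussianReal 0 1) := by
  rw [gaussianReal_of_var_ne_zero 0 one_ne_zero,
    integrable_withDensity_iff_integrable_smul' (measurable_gaussianPDF 0 1)
      (Filter.Eventually.of_forall fun _ => gaussianPDF_lt_top)]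
  simp only [toReal_gaussianPDF]
  have h := (integrable_exp_neg_mul_sq (b := 1 / 4) (by norm_num)).const_mul (√(2 * Real.pi))⁻¹
  refine h.congr (Filter.Eventually.of_forall fun t => ?_)
  simp only [gaussianPDFReal, NNReal.coe_one, mul_one, sub_zero, smul_eq_mul]
  rw [mul_assoc, ← Real.exp_add]
  congr 2
  ring

/-- The number of coordinates of `x` that are at most `s`. -/
noncomputable def countLE {n : ℕ} (x : Fin n → ℝ) (s : ℝ) : ℕ :=
  (Finset.univ.filter fun l => x l ≤ s).card

lemma countLE_mono {n : ℕ} (x : Fin n → ℝ) : Monotone (countLE x) := fun s t hst =>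
  Finset.card_le_card fun l hl => by
    simp only [Finset.mem_filter] at hl ⊢
    exact ⟨hl.1, hl.2.trans hst⟩

lemma lt_countLE_iff {n : ℕ} (x : Fin n → ℝ) (s : ℝ) (k : Fin n) :
    (k : ℕ) < countLE x s ↔ x (Tuple.sort x k) ≤ s := by
  have h := Tuple.lt_card_le_iff_apply_le_of_monotone (a := s) (j := k) (Tuple.monotone_sort x)
  rw [countLE, ← Fintype.card_subtype]
  rw [← Fintype.card_congr ((Tuple.sort x).subtypeEquiv
    (p := fun l => (x ∘ Tuple.sort x) l ≤ s) (q := fun l => x l ≤ s) fun _ => Iff.rfl),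
    Fintype.card_subtype]
  exact h

lemma apply_roundPerm_le {n : ℕ} (U : Matrix (Fin n) (Fin n) ℝ) (x : Fin n → ℝ) (i : Fin n)
    {s : ℝ} (h : countLE (U.mulVec x) (U.mulVec x i) ≤ countLE x s) :
    x ((roundPerm U x)⁻¹ i) ≤ s := by
  have hk := lt_countLE_iff (U.mulVec x) (U.mulVec x i) ((Tuple.sort (U.mulVec x))⁻¹ i)
  rw [show Tuple.sort (U.mulVec x) ((Tuple.sort (U.mulVec x))⁻¹ i) = i from
    Equiv.apply_symm_apply _ _] at hk
  simp only [roundPerm, _root_.mul_inv_rev, inv_inv, Equiv.Perm.mul_apply]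
  exact (lt_countLE_iff x s _).1 ((hk.2 le_rfl).trans_le h)

lemma lt_apply_roundPerm {n : ℕ} (U : Matrix (Fin n) (Fin n) ℝ) (x : Fin n → ℝ) (i : Fin n)
    {s s' : ℝ} (hs' : s' < U.mulVec x i) (h : countLE x s ≤ countLE (U.mulVec x) s') :
    s < x ((roundPerm U x)⁻¹ i) := by
  have hk := lt_countLE_iff (U.mulVec x) s' ((Tuple.sort (U.mulVec x))⁻¹ i)
  rw [show Tuple.sort (U.mulVec x) ((Tuple.sort (U.mulVec x))⁻¹ i) = i from
    Equiv.apply_symm_apply _ _] at hk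
  simp only [roundPerm, _root_.mul_inv_rev, inv_inv, Equiv.Perm.mul_apply]
  by_contra hle
  exact hs'.not_ge (hk.1 (((lt_countLE_iff x s _).2 (not_lt.1 hle)).trans_le h))

lemma countLE_sub_eq_sum {n : ℕ} (x : Fin n → ℝ) (s p : ℝ) :
    (countLE x s : ℝ) - n * p = ∑ l, ((Set.Iic s).indicator 1 (x l) - p) := by
  rw [Finset.sum_sub_distrib, countLE, Finset.card_filter]
  simp [Set.indicator_apply]

instance isProbabilityMeasure_stdGaussianMeasure (n : ℕ) :
    IsProbabilityMeasure (stdGaussianMeasure n) := by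
  unfold stdGaussianMeasure
  infer_instance

lemma measurePreserving_eval_stdGaussianMeasure {n : ℕ} (j : Fin n) :
    MeasurePreserving (fun x : Fin n → ℝ => x j) (stdGaussianMeasure n) (gaussianReal 0 1) :=
  measurePreserving_eval (fun _ => gaussianReal 0 1) j

lemma measurePreserving_mulVec_stdGaussianMeasure {n : ℕ} {U : Matrix (Fin n) (Fin n) ℝ}
    (hU : U * Uᵀ = 1) :
    MeasurePreserving (fun x => U.mulVec x) (stdGaussianMeasure n) (stdGaussianMeasure n) := by
  have hmeas : Measurable fun x : Fin n → ℝ => U.mulVec x :=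
    (Continuous.matrix_mulVec continuous_const continuous_id).measurable
  refine ⟨hmeas, ?_⟩
  have hU' : Uᵀ * U = 1 := mul_eq_one_comm.1 hU
  have hnorm : ∀ v : EuclideanSpace ℝ (Fin n), ‖Matrix.toEuclideanLin U v‖ = ‖v‖ := by
    intro v
    have h1 : U.mulVec v.ofLp ⬝ᵥ U.mulVec v.ofLp = v.ofLp ⬝ᵥ v.ofLp := by
      rw [Matrix.dotProduct_mulVec, ← Matrix.mulVec_transpose, Matrix.mulVec_mulVec, hU',
        Matrix.one_mulVec]
    have h2 : ‖Matrix.toEuclideanLin U v‖ ^ 2 = ‖v‖ ^ 2 := by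
      rw [EuclideanSpace.real_norm_sq_eq, EuclideanSpace.real_norm_sq_eq]
      simpa [dotProduct, sq] using h1
    exact (sq_eq_sq₀ (norm_nonneg _) (norm_nonneg _)).1 h2
  let e : EuclideanSpace ℝ (Fin n) ≃ₗᵢ[ℝ] EuclideanSpace ℝ (Fin n) :=
    LinearIsometry.toLinearIsometryEquiv ⟨Matrix.toEuclideanLin U, hnorm⟩ rfl
  have h1 := stdGaussian_map e
  rw [← map_pi_eq_stdGaussian, Measure.map_map (by fun_prop) (by fun_prop)] at h1
  have h2 := congrArg (Measure.map (WithLp.ofLp : EuclideanSpace ℝ (Fin n) → Fin n → ℝ)) h1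
  rw [Measure.map_map (by fun_prop) (by fun_prop),
    Measure.map_map (by fun_prop) (by fun_prop)] at h2
  have h3 : ((WithLp.ofLp : EuclideanSpace ℝ (Fin n) → Fin n → ℝ) ∘ WithLp.toLp 2) = id := rfl
  rw [h3, Measure.map_id] at h2
  exact h2

lemma integral_exp_indicator_sub_le (s : ℝ) {r : ℝ} (hr : |r| ≤ 1) :
    ∫ v, Real.exp (r * ((Set.Iic s).indicator 1 v - stdCDF s)) ∂(gaussianReal 0 1)
      ≤ Real.exp (r ^ 2 * min (stdCDF s) (1 - stdCDF s)) := by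
  set p := stdCDF s with hp
  have hp0 : 0 < p := stdCDF_pos s
  have hp1 : p < 1 := stdCDF_lt_one s
  have hind : Integrable ((Set.Iic s).indicator (1 : ℝ → ℝ)) (gaussianReal 0 1) :=
    (integrable_const (1 : ℝ)).indicator measurableSet_Iic
  have hint : ∫ v, (Set.Iic s).indicator (1 : ℝ → ℝ) v ∂(gaussianReal 0 1) = p := by
    rw [integral_indicator_one measurableSet_Iic, hp, stdCDF_eq_real]
  have hbound : ∀ v, Real.exp (r * ((Set.Iic s).indicator 1 v - p))
      ≤ (1 - r * p + r ^ 2 * p ^ 2)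
        + (r + r ^ 2 * (1 - 2 * p)) * (Set.Iic s).indicator (1 : ℝ → ℝ) v := by
    intro v
    have hz : |r * ((Set.Iic s).indicator 1 v - p)| ≤ 1 := by
      rw [abs_mul]
      refine mul_le_one₀ hr (abs_nonneg _) ?_
      by_cases hv : v ∈ Set.Iic s
      · rw [Set.indicator_of_mem hv, Pi.one_apply, abs_le]
        constructor <;> linarith
      · rw [Set.indicator_of_notMem hv, abs_le]
        constructor <;> linarith
    have h := (abs_le.1 (Real.abs_exp_sub_one_sub_id_le hz)).2
    by_cases hv : v ∈ Set.Iic s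
    · rw [Set.indicator_of_mem hv, Pi.one_apply] at h ⊢
      nlinarith
    · rw [Set.indicator_of_notMem hv] at h ⊢
      nlinarith
  calc _ ≤ ∫ v, ((1 - r * p + r ^ 2 * p ^ 2)
        + (r + r ^ 2 * (1 - 2 * p)) * (Set.Iic s).indicator (1 : ℝ → ℝ) v) ∂(gaussianReal 0 1) :=
        integral_mono_of_nonneg (Filter.Eventually.of_forall fun v => (Real.exp_pos _).le)
          ((integrable_const _).add (hind.const_mul _)) (Filter.Eventually.of_forall hbound)
    _ = r ^ 2 * (p * (1 - p)) + 1 := by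
        rw [integral_add (integrable_const _) (hind.const_mul _), integral_const_mul, hint]
        simp
        ring
    _ ≤ r ^ 2 * min p (1 - p) + 1 := by
        have : p * (1 - p) ≤ min p (1 - p) := le_min (by nlinarith) (by nlinarith)
        gcongr
    _ ≤ _ := Real.add_one_le_exp _

lemma real_le_mul_countLE_sub_le (n : ℕ) (s : ℝ) {ε r : ℝ} (hε : |ε| = 1) (hr : 0 ≤ r)
    (hpos : 0 < n * min (stdCDF s) (1 - stdCDF s))
    (hrs : r ≤ 2 * (n * min (stdCDF s) (1 - stdCDF s))) :
    (stdGaussianMeasure n).real {x | r ≤ ε * (countLE x s - n * stdCDF s)}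
      ≤ Real.exp (-(r ^ 2 / (4 * (n * min (stdCDF s) (1 - stdCDF s))))) := by
  set H := n * min (stdCDF s) (1 - stdCDF s) with hH
  set a := r / (2 * H) with ha
  have ha0 : 0 ≤ a := by positivity
  have ha1 : a ≤ 1 := (div_le_one (by positivity)).2 hrs
  have haε : |a * ε| ≤ 1 := by rw [abs_mul, hε, abs_of_nonneg ha0, mul_one]; exact ha1
  have hmeas : ∀ l : Fin n, Measurable fun x : Fin n → ℝ =>
      (Set.Iic s).indicator (1 : ℝ → ℝ) (x l) := fun l =>
    (measurable_const.indicator measurableSet_Iic).comp (measurable_pi_apply l)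
  have hexp : ∀ x : Fin n → ℝ, Real.exp (a * (ε * (countLE x s - n * stdCDF s)))
      = ∏ l, Real.exp (a * ε * ((Set.Iic s).indicator 1 (x l) - stdCDF s)) := by
    intro x
    rw [countLE_sub_eq_sum, ← Real.exp_sum, ← Finset.mul_sum, mul_assoc]
  have hint1 : Integrable (fun v => Real.exp (a * ε * ((Set.Iic s).indicator 1 v - stdCDF s)))
      (gaussianReal 0 1) := by
    refine Integrable.of_bound (C := Real.exp 1) ?_ (Filter.Eventually.of_forall fun v => ?_)
    · have : Measurable ((Set.Iic s).indicator (1 : ℝ → ℝ)) :=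
        measurable_const.indicator measurableSet_Iic
      exact (Real.measurable_exp.comp ((this.sub_const _).const_mul _)).aestronglyMeasurable
    · rw [Real.norm_of_nonneg (Real.exp_pos _).le, Real.exp_le_exp]
      refine (le_abs_self _).trans ?_
      rw [abs_mul]
      refine mul_le_one₀ haε (abs_nonneg _) ?_
      have hp0 := stdCDF_pos s
      have hp1 := stdCDF_lt_one s
      by_cases hv : v ∈ Set.Iic s
      · rw [Set.indicator_of_mem hv, Pi.one_apply, abs_le]
        constructor <;> linarith
      · rw [Set.indicator_of_notMem hv, abs_le]
        constructor <;> linarith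
  have hint : Integrable (fun x : Fin n → ℝ =>
      Real.exp (a * (ε * (countLE x s - n * stdCDF s)))) (stdGaussianMeasure n) := by
    simp_rw [hexp]
    exact Integrable.fintype_prod fun _ => hint1
  have h := measure_ge_le_exp_mul_mgf (X := fun x : Fin n → ℝ =>
    ε * (countLE x s - n * stdCDF s)) r ha0 hint
  have hmgf : mgf (fun x : Fin n → ℝ => ε * (countLE x s - n * stdCDF s))
      (stdGaussianMeasure n) a ≤ Real.exp (a ^ 2 * H) := by
    rw [mgf]
    simp_rw [hexp]
    rw [stdGaussianMeasure, integral_fintype_prod_eq_pow (ι := Fin n) (fun v : ℝ =>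
      Real.exp (a * ε * ((Set.Iic s).indicator 1 v - stdCDF s))), Fintype.card_fin]
    refine (pow_le_pow_left₀ (integral_nonneg fun v => (Real.exp_pos _).le)
      (integral_exp_indicator_sub_le s haε) n).trans ?_
    rw [← Real.exp_nat_mul, Real.exp_le_exp, mul_pow, ← sq_abs ε, hε, hH]
    exact le_of_eq (by ring)
  refine h.trans ((mul_le_mul_of_nonneg_left hmgf (Real.exp_pos _).le).trans ?_)
  rw [← Real.exp_add, Real.exp_le_exp, ha]
  refine le_of_eq ?_
  field_simp
  ring

/-- `n` times the smaller of the two Gaussian tails at `s`. -/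
noncomputable def tailMass (n : ℕ) (s : ℝ) : ℝ := n * min (stdCDF s) (1 - stdCDF s)

/-- The counts of `x` at the `n`-quantiles of the Gaussian law, away from the extreme tails, are
within the Chernoff scale of their means. -/
def IsConcentrated {n : ℕ} (x : Fin n → ℝ) : Prop :=
  ∀ s, (∃ m : ℕ, n * stdCDF s = m) → 4 * Real.log n ≤ tailMass n s →
    |countLE x s - n * stdCDF s| ≤ 4 * √(tailMass n s * Real.log n)

lemma exists_threshold {n : ℕ} (hn : 2 ≤ n) {x y : Fin n → ℝ} (hx : IsConcentrated x)
    (hy : IsConcentrated y) {t : ℝ} (ht : 10 ^ 4 * Real.log n ≤ tailMass n t) (m : ℤ)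
    (hm : |m - n * stdCDF t| ≤ tailMass n t / 2) :
    ∃ s, n * stdCDF s = m ∧ |countLE x s - (m : ℝ)| ≤ 6 * √(tailMass n t * Real.log n) ∧
      |countLE y s - (m : ℝ)| ≤ 6 * √(tailMass n t * Real.log n) ∧
      tailMass n t * |s - t| ≤ 2 * √(2 * Real.pi) * |m - n * stdCDF t| := by
  have hn0 : (0 : ℝ) < n := by positivity
  have hL : 0 < Real.log n := Real.log_pos (by exact_mod_cast hn)
  set L := Real.log n
  set H := tailMass n t with hH
  have hH1 : H ≤ n * stdCDF t := mul_le_mul_of_nonneg_left (min_le_left _ _) hn0.le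
  have hH2 : H ≤ n * (1 - stdCDF t) := mul_le_mul_of_nonneg_left (min_le_right _ _) hn0.le
  have hm' := abs_le.1 hm
  have hm0 : (0 : ℝ) < m := by linarith
  have hmn : (m : ℝ) < n := by linarith
  obtain ⟨s, hs⟩ := exists_stdCDF_eq (p := m / n) (by positivity) ((div_lt_one hn0).2 hmn)
  have hs' : n * stdCDF s = m := by rw [hs]; field_simp
  have hlow : H / 2 ≤ tailMass n s := by
    rw [tailMass, mul_min_of_nonneg _ _ hn0.le]
    exact le_min (by linarith) (by linarith)
  have hup : tailMass n s ≤ 2 * H := by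
    rw [hH, tailMass, tailMass, mul_min_of_nonneg _ _ hn0.le]
    rcases min_choice (stdCDF t) (1 - stdCDF t) with h | h
    · have : H = n * stdCDF t := by rw [hH, tailMass, h]
      rw [h]
      exact (min_le_left _ _).trans (by linarith)
    · have : H = n * (1 - stdCDF t) := by rw [hH, tailMass, h]
      rw [h]
      exact (min_le_right _ _).trans (by linarith)
  have hmnat : ∃ k : ℕ, n * stdCDF s = k := by
    refine ⟨m.toNat, ?_⟩
    rw [hs']
    have : ((m.toNat : ℤ) : ℝ) = m := by
      rw [Int.toNat_of_nonneg (by exact_mod_cast hm0.le)]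
    exact_mod_cast this.symm
  have hsqrt : 4 * √(tailMass n s * L) ≤ 6 * √(H * L) := by
    have h1 : √(tailMass n s * L) ≤ √((3 / 2) ^ 2 * (H * L)) := by
      apply Real.sqrt_le_sqrt
      nlinarith
    rw [Real.sqrt_mul (x := (3 / 2) ^ 2) (by positivity),
      Real.sqrt_sq (by norm_num)] at h1
    linarith
  refine ⟨s, hs', ?_, ?_, ?_⟩
  · rw [← hs']
    exact (hx s hmnat (by linarith)).trans hsqrt
  · rw [← hs']
    exact (hy s hmnat (by linarith)).trans hsqrt
  · have hlow1 : H / 2 ≤ n * stdCDF s :=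
      hlow.trans (mul_le_mul_of_nonneg_left (min_le_left _ _) hn0.le)
    have hlow2 : H / 2 ≤ n * (1 - stdCDF s) :=
      hlow.trans (mul_le_mul_of_nonneg_left (min_le_right _ _) hn0.le)
    have ha : ∀ {z : ℝ}, H / 2 ≤ n * z → H / (2 * n) ≤ z := fun {z} h => by
      rw [div_le_iff₀ (by positivity)]
      linarith
    have hHpos : 0 < H := lt_of_lt_of_le (by positivity) ht
    have e1 : (m : ℝ) - n * stdCDF t = n * (stdCDF s - stdCDF t) := by rw [← hs']; ring
    rw [e1, abs_mul, abs_of_pos hn0]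
    have key : H / (2 * n) * |s - t| ≤ √(2 * Real.pi) * |stdCDF s - stdCDF t| := by
      rcases le_total s t with hst | hst
      · rw [abs_sub_comm s, abs_sub_comm (stdCDF s), abs_of_nonneg (sub_nonneg.2 hst),
          abs_of_nonneg (sub_nonneg.2 (strictMono_stdCDF.monotone hst))]
        exact mul_sub_le_stdCDF_sub hst (ha hlow1) (ha (by linarith))
      · rw [abs_of_nonneg (sub_nonneg.2 hst),
          abs_of_nonneg (sub_nonneg.2 (strictMono_stdCDF.monotone hst))]
        exact mul_sub_le_stdCDF_sub hst (ha (by linarith)) (ha hlow2)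
    calc H * |s - t| = 2 * n * (H / (2 * n) * |s - t|) := by field_simp
      _ ≤ 2 * n * (√(2 * Real.pi) * |stdCDF s - stdCDF t|) := by gcongr
      _ = _ := by ring

lemma zeta_sq_le_of_isConcentrated {n : ℕ} (hn : 2 ≤ n) {U : Matrix (Fin n) (Fin n) ℝ}
    {x : Fin n → ℝ} (hx : IsConcentrated x) (hy : IsConcentrated (U.mulVec x)) (i : Fin n)
    (ht : 10 ^ 4 * Real.log n ≤ tailMass n (U.mulVec x i)) :
    zeta U x i ^ 2 ≤ 10 ^ 4 * Real.log n / tailMass n (U.mulVec x i) := by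
  have hL : 1 / 2 < Real.log n := by
    have h1 := Real.log_two_gt_d9
    have h2 : Real.log 2 ≤ Real.log n := Real.log_le_log two_pos (by exact_mod_cast hn)
    linarith
  set t := U.mulVec x i with ht_def
  set L := Real.log n
  set H := tailMass n t
  have hHpos : 0 < H := lt_of_lt_of_le (by positivity) ht
  set D := √(H * L) with hD
  have hDsq : D ^ 2 = H * L := Real.sq_sqrt (by positivity)
  have hD0 : 0 ≤ D := Real.sqrt_nonneg _
  have hDH : 100 * D ≤ H := by
    refine abs_le_of_sq_le_sq' ?_ hHpos.le |>.2
    nlinarith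
  have hD50 : 50 ≤ D := by
    refine abs_le_of_sq_le_sq' ?_ hD0 |>.2
    nlinarith
  set e := ⌈n * stdCDF t⌉ with he
  have he1 : n * stdCDF t ≤ e := Int.le_ceil _
  have he2 : (e : ℝ) < n * stdCDF t + 1 := Int.ceil_lt_add_one _
  set d := ⌈12 * D⌉ with hd
  have hd1 : 12 * D ≤ d := Int.le_ceil _
  have hd2 : (d : ℝ) < 12 * D + 1 := Int.ceil_lt_add_one _
  have hpi : √(2 * Real.pi) ≤ 3 := by
    rw [Real.sqrt_le_left (by norm_num)]
    linarith [Real.pi_lt_four]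
  have hgap : ∀ {s : ℝ} {m : ℤ}, |(m : ℝ) - n * stdCDF t| ≤ d + 1 →
      H * |s - t| ≤ 2 * √(2 * Real.pi) * |m - n * stdCDF t| → |s - t| ≤ 100 * D / H := by
    intro s m h1 h2
    rw [le_div_iff₀' hHpos]
    refine h2.trans ?_
    calc 2 * √(2 * Real.pi) * |(m : ℝ) - n * stdCDF t| ≤ 2 * 3 * (12 * D + 2) := by
          gcongr
          linarith
      _ ≤ 100 * D := by linarith
  have hupper : x ((roundPerm U x)⁻¹ i) - t ≤ 100 * D / H := by
    have hm : |((e + d : ℤ) : ℝ) - n * stdCDF t| ≤ d + 1 := by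
      push_cast
      rw [abs_le]
      constructor <;> linarith
    obtain ⟨s, hs, hsx, -, hst⟩ := exists_threshold hn hx hy ht (e + d) (by linarith)
    obtain ⟨s', hs', -, hsy', -⟩ := exists_threshold hn hx hy ht e (by
      rw [abs_le]
      constructor <;> linarith)
    have hts' : t ≤ s' := by
      rw [← strictMono_stdCDF.le_iff_le]
      have hn0 : (0 : ℝ) < n := by positivity
      exact le_of_mul_le_mul_left (he1.trans hs'.ge) hn0
    have hle : x ((roundPerm U x)⁻¹ i) ≤ s := by
      refine apply_roundPerm_le U x i ((countLE_mono _ hts').trans ?_)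
      have h1 := abs_le.1 hsx
      have h2 := abs_le.1 hsy'
      push_cast at h1
      have : (countLE (U.mulVec x) s' : ℝ) ≤ countLE x s := by linarith
      exact_mod_cast this
    linarith [le_abs_self (s - t), hgap hm hst]
  have hlower : t - x ((roundPerm U x)⁻¹ i) ≤ 100 * D / H := by
    have hm : |((e - 1 - d : ℤ) : ℝ) - n * stdCDF t| ≤ d + 1 := by
      push_cast
      rw [abs_le]
      constructor <;> linarith
    obtain ⟨s, hs, hsx, -, hst⟩ := exists_threshold hn hx hy ht (e - 1 - d) (by linarith)
    obtain ⟨s', hs', -, hsy', -⟩ := exists_threshold hn hx hy ht (e - 1) (by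
      push_cast
      rw [abs_le]
      constructor <;> linarith)
    have hts' : s' < t := by
      rw [← strictMono_stdCDF.lt_iff_lt]
      have hn0 : (0 : ℝ) < n := by positivity
      push_cast at hs'
      exact lt_of_mul_lt_mul_left (by linarith) hn0.le
    have hle : s < x ((roundPerm U x)⁻¹ i) := by
      refine lt_apply_roundPerm U x i hts' ?_
      have h1 := abs_le.1 hsx
      have h2 := abs_le.1 hsy'
      push_cast at h1 h2
      have : (countLE x s : ℝ) ≤ countLE (U.mulVec x) s' := by linarith
      exact_mod_cast this
    linarith [neg_abs_le (s - t), hgap hm hst]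
  have habs : zeta U x i ^ 2 ≤ (100 * D / H) ^ 2 := by
    refine sq_le_sq' ?_ ?_ <;> rw [zeta] <;> linarith
  refine habs.trans (le_of_eq ?_)
  rw [div_pow, mul_pow, hDsq]
  field_simp
  norm_num

lemma real_lt_abs_countLE_sub_le {n : ℕ} (hn : 2 ≤ n) {s : ℝ}
    (hs : 4 * Real.log n ≤ tailMass n s) :
    (stdGaussianMeasure n).real
      {x | 4 * √(tailMass n s * Real.log n) < |countLE x s - n * stdCDF s|} ≤ 2 / n ^ 2 := by
  have hn1 : (1 : ℝ) < n := by exact_mod_cast hn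
  have hL : 0 < Real.log n := Real.log_pos hn1
  have hH : 0 < tailMass n s := lt_of_lt_of_le (by positivity) hs
  have hsq : √(tailMass n s * Real.log n) ^ 2 = tailMass n s * Real.log n :=
    Real.sq_sqrt (by positivity)
  have hr0 : 0 ≤ 4 * √(tailMass n s * Real.log n) := by positivity
  have hr : 4 * √(tailMass n s * Real.log n) ≤ 2 * tailMass n s := by
    refine (abs_le_of_sq_le_sq' ?_ (by positivity)).2
    nlinarith
  have hexp : Real.exp (-((4 * √(tailMass n s * Real.log n)) ^ 2 / (4 * tailMass n s)))
      ≤ 1 / n ^ 2 := by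
    have h1 : (4 * √(tailMass n s * Real.log n)) ^ 2 / (4 * tailMass n s) = 4 * Real.log n := by
      rw [mul_pow, hsq]
      field_simp
    have h2 : (1 : ℝ) / n ^ 2 = Real.exp (-(2 * Real.log n)) := by
      rw [Real.exp_neg, two_mul, Real.exp_add, Real.exp_log (by linarith), one_div, sq]
    rw [h1, h2, Real.exp_le_exp]
    linarith
  have hup := (real_le_mul_countLE_sub_le n s (ε := 1) (by simp) hr0 hH hr).trans hexp
  have hlo := (real_le_mul_countLE_sub_le n s (ε := -1) (by simp) hr0 hH hr).trans hexp
  refine (measureReal_mono (s₂ := {x | 4 * √(tailMass n s * Real.log n)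
      ≤ 1 * (countLE x s - n * stdCDF s)} ∪ {x | 4 * √(tailMass n s * Real.log n)
      ≤ -1 * (countLE x s - n * stdCDF s)}) ?_).trans
    ((measureReal_union_le _ _).trans ((add_le_add hup hlo).trans (le_of_eq (by ring))))
  intro x hx
  rcases lt_abs.1 (Set.mem_ofPred_eq ▸ hx) with h | h
  · left
    simpa using h.le
  · right
    simpa using h.le

lemma real_not_isConcentrated_le {n : ℕ} (hn : 2 ≤ n) :
    (stdGaussianMeasure n).real {x | ¬ IsConcentrated x} ≤ 2 / n := by
  have hn0 : (0 : ℝ) < n := by positivity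
  set E : ℕ → Set (Fin n → ℝ) := fun m => {x | ∃ s, n * stdCDF s = m ∧
    4 * Real.log n ≤ tailMass n s ∧
    4 * √(tailMass n s * Real.log n) < |countLE x s - n * stdCDF s|} with hE
  have hsub : {x : Fin n → ℝ | ¬ IsConcentrated x} ⊆ ⋃ m ∈ Finset.range n, E m := by
    intro x hx
    simp only [Set.mem_ofPred_eq, IsConcentrated, not_forall, not_le] at hx
    obtain ⟨s, ⟨m, hm⟩, hs, hlt⟩ := hx
    have hmn : m < n := by
      have : (m : ℝ) < n := by
        rw [← hm]
        exact mul_lt_of_lt_one_right hn0 (stdCDF_lt_one s)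
      exact_mod_cast this
    exact Set.mem_biUnion (Finset.mem_coe.2 (Finset.mem_range.2 hmn)) ⟨s, hm, hs, hlt⟩
  have hEm : ∀ m, (stdGaussianMeasure n).real (E m) ≤ 2 / n ^ 2 := by
    intro m
    by_cases hm : ∃ s, n * stdCDF s = m ∧ 4 * Real.log n ≤ tailMass n s
    · obtain ⟨s, hm, hs⟩ := hm
      refine (measureReal_mono ?_).trans (real_lt_abs_countLE_sub_le hn hs)
      rintro x ⟨s', hm', -, hlt⟩
      have : s' = s := strictMono_stdCDF.injective (mul_left_cancel₀ hn0.ne' (hm'.trans hm.symm))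
      exact this ▸ hlt
    · have : E m = ∅ := Set.eq_empty_of_forall_notMem fun x ⟨s, h1, h2, _⟩ => hm ⟨s, h1, h2⟩
      rw [this, measureReal_empty]
      positivity
  calc _ ≤ (stdGaussianMeasure n).real (⋃ m ∈ Finset.range n, E m) :=
      measureReal_mono hsub (measure_ne_top _ _)
    _ ≤ ∑ m ∈ Finset.range n, (stdGaussianMeasure n).real (E m) :=
      measureReal_biUnion_finset_le _ _
    _ ≤ ∑ _m ∈ Finset.range n, (2 : ℝ) / n ^ 2 := Finset.sum_le_sum fun m _ => hEm m
    _ = 2 / n := by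
      rw [Finset.sum_const, Finset.card_range, nsmul_eq_mul]
      field_simp

/-- The number of Gaussian tails at `t` that have mass at most `u`. -/
noncomputable def tailIndicator (u t : ℝ) : ℝ :=
  {t | stdCDF t ≤ u}.indicator 1 t + {t | 1 - stdCDF t ≤ u}.indicator 1 t

lemma measurableSet_stdCDF_le (u : ℝ) : MeasurableSet {t | stdCDF t ≤ u} :=
  measurableSet_le continuous_stdCDF.measurable measurable_const

lemma measurableSet_one_sub_stdCDF_le (u : ℝ) : MeasurableSet {t | 1 - stdCDF t ≤ u} :=
  measurableSet_le (continuous_stdCDF.measurable.const_sub 1) measurable_const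

lemma integrable_tailIndicator (u : ℝ) : Integrable (tailIndicator u) (gaussianReal 0 1) :=
  ((integrable_const (1 : ℝ)).indicator (measurableSet_stdCDF_le u)).add
    ((integrable_const (1 : ℝ)).indicator (measurableSet_one_sub_stdCDF_le u))

lemma integral_tailIndicator_le {u : ℝ} (hu : 0 ≤ u) :
    ∫ t, tailIndicator u t ∂(gaussianReal 0 1) ≤ 2 * u := by
  have h1 : Integrable ({t | stdCDF t ≤ u}.indicator (1 : ℝ → ℝ)) (gaussianReal 0 1) :=
    (integrable_const (1 : ℝ)).indicator (measurableSet_stdCDF_le u)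
  have h2 : Integrable ({t | 1 - stdCDF t ≤ u}.indicator (1 : ℝ → ℝ)) (gaussianReal 0 1) :=
    (integrable_const (1 : ℝ)).indicator (measurableSet_one_sub_stdCDF_le u)
  unfold tailIndicator
  rw [integral_add h1 h2, integral_indicator_one (measurableSet_stdCDF_le u),
    integral_indicator_one (measurableSet_one_sub_stdCDF_le u), two_mul]
  exact add_le_add (real_stdCDF_le_le hu) (real_one_sub_stdCDF_le_le hu)

lemma tailIndicator_nonneg (u t : ℝ) : 0 ≤ tailIndicator u t :=
  add_nonneg (Set.indicator_nonneg (fun _ _ => zero_le_one) _)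
    (Set.indicator_nonneg (fun _ _ => zero_le_one) _)

lemma one_le_tailIndicator {u t : ℝ} (h : min (stdCDF t) (1 - stdCDF t) ≤ u) :
    1 ≤ tailIndicator u t := by
  rcases min_le_iff.1 h with h | h
  · rw [tailIndicator, Set.indicator_of_mem (Set.mem_ofPred_eq ▸ h), Pi.one_apply]
    exact le_add_of_nonneg_right (Set.indicator_nonneg (fun _ _ => zero_le_one) _)
  · rw [tailIndicator, Set.indicator_of_mem (s := {t | 1 - stdCDF t ≤ u})
      (Set.mem_ofPred_eq ▸ h), Pi.one_apply]
    exact le_add_of_nonneg_left (Set.indicator_nonneg (fun _ _ => zero_le_one) _)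

lemma inv_min_stdCDF_le {n : ℕ} {t : ℝ} (h : 1 ≤ n * min (stdCDF t) (1 - stdCDF t)) :
    (min (stdCDF t) (1 - stdCDF t))⁻¹
      ≤ 1 + ∑ m ∈ Finset.range n, tailIndicator (1 / ((m : ℝ) + 1)) t := by
  set p := min (stdCDF t) (1 - stdCDF t) with hp
  have hp0 : 0 < p := lt_min (stdCDF_pos t) (sub_pos.2 (stdCDF_lt_one t))
  have hfl : ⌊p⁻¹⌋₊ ≤ n := by
    refine Nat.floor_le_of_le ?_
    rw [inv_le_iff_one_le_mul₀ hp0]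
    exact h
  have h1 : ∑ m ∈ Finset.range ⌊p⁻¹⌋₊, (1 : ℝ)
      ≤ ∑ m ∈ Finset.range n, tailIndicator (1 / ((m : ℝ) + 1)) t := by
    refine (Finset.sum_le_sum fun m hm => one_le_tailIndicator ?_).trans
      (Finset.sum_le_sum_of_subset_of_nonneg (Finset.range_mono hfl)
        fun m _ _ => tailIndicator_nonneg _ _)
    rw [← hp, le_div_iff₀ (by positivity), mul_comm, ← le_div_iff₀ hp0, one_div]
    have h2 := (Nat.le_floor_iff (inv_nonneg.2 hp0.le)).1 (Finset.mem_range.1 hm)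
    exact_mod_cast h2
  rw [Finset.sum_const, Finset.card_range, nsmul_eq_mul, mul_one] at h1
  linarith [Nat.lt_floor_add_one p⁻¹]

/-- A majorant, in terms of `t = (U x) i`, of the part of `(ζ i)²` that is governed by `t`. -/
noncomputable def coordMajorant (n : ℕ) (t : ℝ) : ℝ :=
  10 ^ 4 * (Real.log n / n) * (1 + ∑ m ∈ Finset.range n, tailIndicator (1 / ((m : ℝ) + 1)) t)
    + 64 * Real.log n * tailIndicator (10 ^ 4 * Real.log n / n) t

lemma integrable_coordMajorant (n : ℕ) : Integrable (coordMajorant n) (gaussianReal 0 1) :=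
  (((integrable_const _).add (integrable_finsetSum _ fun _ _ =>
    integrable_tailIndicator _)).const_mul _).add ((integrable_tailIndicator _).const_mul _)

lemma integral_coordMajorant_le {n : ℕ} (hn : 2 ≤ n) :
    ∫ t, coordMajorant n t ∂(gaussianReal 0 1)
      ≤ 10 ^ 4 * (Real.log n / n) * (1 + 2 * (1 + Real.log n))
        + 64 * Real.log n * (2 * (10 ^ 4 * Real.log n / n)) := by
  have hL : 0 < Real.log n := Real.log_pos (by exact_mod_cast hn)
  have hs : Integrable (fun t => ∑ m ∈ Finset.range n, tailIndicator (1 / ((m : ℝ) + 1)) t)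
      (gaussianReal 0 1) := integrable_finsetSum _ fun _ _ => integrable_tailIndicator _
  have hs1 : Integrable (fun t => 1 + ∑ m ∈ Finset.range n, tailIndicator (1 / ((m : ℝ) + 1)) t)
      (gaussianReal 0 1) := (integrable_const _).add hs
  have hsum : ∑ m ∈ Finset.range n, 2 * (1 / ((m : ℝ) + 1)) ≤ 2 * (1 + Real.log n) := by
    rw [← Finset.mul_sum]
    have h := harmonic_le_one_add_log n
    rw [harmonic] at h
    push_cast at h
    simpa using h
  unfold coordMajorant
  rw [integral_add (hs1.const_mul _) ((integrable_tailIndicator _).const_mul _),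
    integral_const_mul, integral_const_mul, integral_add (integrable_const _) hs,
    integral_finsetSum _ fun _ _ => integrable_tailIndicator _]
  simp only [integral_const, probReal_univ, one_smul]
  gcongr
  · exact (Finset.sum_le_sum fun m _ => integral_tailIndicator_le (by positivity)).trans hsum
  · exact integral_tailIndicator_le (by positivity)

lemma sq_le_log_add_exp {n : ℕ} (hn : 2 ≤ n) (v : ℝ) :
    v ^ 2 ≤ 16 * Real.log n + 8 / n ^ 2 * Real.exp (v ^ 2 / 4) := by
  have hn1 : (1 : ℝ) < n := by exact_mod_cast hn
  have hL : 0 < Real.log n := Real.log_pos hn1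
  rcases le_or_gt (v ^ 2) (16 * Real.log n) with h | h
  · exact h.trans (le_add_of_nonneg_right (by positivity))
  · have h1 : v ^ 2 / 8 ≤ Real.exp (v ^ 2 / 8) := by linarith [Real.add_one_le_exp (v ^ 2 / 8)]
    have h2 : (n : ℝ) ^ 2 ≤ Real.exp (v ^ 2 / 8) := by
      have : (n : ℝ) ^ 2 = Real.exp (2 * Real.log n) := by
        rw [two_mul, Real.exp_add, Real.exp_log (by linarith), sq]
      rw [this, Real.exp_le_exp]
      linarith
    have h3 : Real.exp (v ^ 2 / 4) = Real.exp (v ^ 2 / 8) * Real.exp (v ^ 2 / 8) := by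
      rw [← Real.exp_add]
      congr 1
      ring
    have h4 : Real.exp (v ^ 2 / 8) ≤ Real.exp (v ^ 2 / 4) / n ^ 2 := by
      rw [le_div_iff₀ (by positivity), h3]
      gcongr
    calc v ^ 2 ≤ 8 * (Real.exp (v ^ 2 / 4) / n ^ 2) := by linarith
      _ = 8 / n ^ 2 * Real.exp (v ^ 2 / 4) := by ring
      _ ≤ _ := le_add_of_nonneg_left (by positivity)

lemma zeta_sq_le {n : ℕ} (hn : 2 ≤ n) (U : Matrix (Fin n) (Fin n) ℝ) (x : Fin n → ℝ) (i : Fin n)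
    {A : Set (Fin n → ℝ)} (hA : ∀ z ∉ A, IsConcentrated z) :
    zeta U x i ^ 2 ≤ coordMajorant n (U.mulVec x i)
      + 64 * Real.log n * (A.indicator 1 x + A.indicator 1 (U.mulVec x))
      + 16 / n ^ 2 * (Real.exp ((U.mulVec x i) ^ 2 / 4) + ∑ j, Real.exp (x j ^ 2 / 4)) := by
  have hn0 : (0 : ℝ) < n := by positivity
  have hL : 1 / 2 < Real.log n := by
    have h1 := Real.log_two_gt_d9
    have h2 : Real.log 2 ≤ Real.log n := Real.log_le_log two_pos (by exact_mod_cast hn)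
    linarith
  set t := U.mulVec x i with ht
  have hind : ∀ z : Fin n → ℝ, 0 ≤ A.indicator (1 : (Fin n → ℝ) → ℝ) z := fun z =>
    Set.indicator_nonneg (fun _ _ => zero_le_one) _
  have hsum0 : 0 ≤ ∑ m ∈ Finset.range n, tailIndicator (1 / ((m : ℝ) + 1)) t :=
    Finset.sum_nonneg fun m _ => tailIndicator_nonneg _ _
  have hc0 : 0 ≤ 10 ^ 4 * (Real.log n / n) *
      (1 + ∑ m ∈ Finset.range n, tailIndicator (1 / ((m : ℝ) + 1)) t) := by positivity
  have hexp0 : 0 ≤ 16 / (n : ℝ) ^ 2 *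
      (Real.exp (t ^ 2 / 4) + ∑ j, Real.exp (x j ^ 2 / 4)) := by positivity
  by_cases hgood : IsConcentrated x ∧ IsConcentrated (U.mulVec x) ∧
      10 ^ 4 * Real.log n ≤ tailMass n t
  · obtain ⟨hx, hy, hm⟩ := hgood
    have h1 := zeta_sq_le_of_isConcentrated hn hx hy i hm
    have h2 := inv_min_stdCDF_le (n := n) (t := t) (by rw [tailMass] at hm; linarith)
    have h3 : 10 ^ 4 * Real.log n / tailMass n t
        ≤ 10 ^ 4 * (Real.log n / n) *
          (1 + ∑ m ∈ Finset.range n, tailIndicator (1 / ((m : ℝ) + 1)) t) := by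
      calc 10 ^ 4 * Real.log n / tailMass n t
          = 10 ^ 4 * (Real.log n / n) * (min (stdCDF t) (1 - stdCDF t))⁻¹ := by
            rw [tailMass, div_eq_mul_inv, mul_inv]
            ring
        _ ≤ _ := by gcongr
    have h4 : 0 ≤ 64 * Real.log n * tailIndicator (10 ^ 4 * Real.log n / n) t :=
      mul_nonneg (by positivity) (tailIndicator_nonneg _ _)
    have h5 : 0 ≤ 64 * Real.log n * (A.indicator 1 x + A.indicator 1 (U.mulVec x)) :=
      mul_nonneg (by positivity) (add_nonneg (hind _) (hind _))
    rw [coordMajorant]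
    linarith
  · have hbad : 1 ≤ tailIndicator (10 ^ 4 * Real.log n / n) t
        + (A.indicator 1 x + A.indicator 1 (U.mulVec x)) := by
      by_cases hxA : x ∈ A
      · have : A.indicator (1 : (Fin n → ℝ) → ℝ) x = 1 := Set.indicator_of_mem hxA _
        linarith [hind (U.mulVec x), tailIndicator_nonneg (10 ^ 4 * Real.log n / n) t]
      by_cases hyA : U.mulVec x ∈ A
      · have : A.indicator (1 : (Fin n → ℝ) → ℝ) (U.mulVec x) = 1 := Set.indicator_of_mem hyA _
        linarith [hind x, tailIndicator_nonneg (10 ^ 4 * Real.log n / n) t]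
      have hm : tailMass n t < 10 ^ 4 * Real.log n := by
        by_contra hm
        exact hgood ⟨hA _ hxA, hA _ hyA, not_lt.1 hm⟩
      have h1 : 1 ≤ tailIndicator (10 ^ 4 * Real.log n / n) t := by
        refine one_le_tailIndicator ?_
        rw [le_div_iff₀' hn0]
        exact hm.le
      linarith [hind x, hind (U.mulVec x)]
    set k := (roundPerm U x)⁻¹ i with hk
    have h1 := sq_le_log_add_exp hn t
    have h2 := sq_le_log_add_exp hn (x k)
    have h3 : Real.exp (x k ^ 2 / 4) ≤ ∑ j, Real.exp (x j ^ 2 / 4) :=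
      Finset.single_le_sum (f := fun j => Real.exp (x j ^ 2 / 4))
        (fun j _ => (Real.exp_pos _).le) (Finset.mem_univ k)
    have h4 : zeta U x i ^ 2 ≤ 2 * t ^ 2 + 2 * x k ^ 2 := by
      rw [zeta, ← ht, ← hk]
      nlinarith [sq_nonneg (t + x k)]
    have h5 : 8 / (n : ℝ) ^ 2 * Real.exp (x k ^ 2 / 4)
        ≤ 8 / (n : ℝ) ^ 2 * ∑ j, Real.exp (x j ^ 2 / 4) := by gcongr
    have h6 : 16 / (n : ℝ) ^ 2 * (Real.exp (t ^ 2 / 4) + ∑ j, Real.exp (x j ^ 2 / 4))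
        = 2 * (8 / (n : ℝ) ^ 2 * Real.exp (t ^ 2 / 4))
          + 2 * (8 / (n : ℝ) ^ 2 * ∑ j, Real.exp (x j ^ 2 / 4)) := by ring
    have h7 := mul_le_mul_of_nonneg_left hbad (by positivity : 0 ≤ 64 * Real.log n)
    rw [coordMajorant, h6]
    linarith

lemma integral_zeta_sq_le {n : ℕ} (hn : 2 ≤ n) {U : Matrix (Fin n) (Fin n) ℝ} (hU : U * Uᵀ = 1)
    (i : Fin n) :
    ∫ x, zeta U x i ^ 2 ∂(stdGaussianMeasure n)
      ≤ 10 ^ 4 * (Real.log n / n) * (1 + 2 * (1 + Real.log n))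
        + 64 * Real.log n * (2 * (10 ^ 4 * Real.log n / n)) + 64 * Real.log n * (2 / n + 2 / n)
        + 16 / n ^ 2 * ((n + 1) * ∫ v, Real.exp (v ^ 2 / 4) ∂(gaussianReal 0 1)) := by
  have hL : 0 < Real.log n := Real.log_pos (by exact_mod_cast hn)
  set μ := stdGaussianMeasure n with hμ
  set A := toMeasurable μ {x | ¬ IsConcentrated x} with hA_def
  have hA : ∀ z ∉ A, IsConcentrated z := fun z hz => by
    by_contra h
    exact hz (subset_toMeasurable μ {x | ¬ IsConcentrated x} h)
  have hAm : MeasurableSet A := measurableSet_toMeasurable _ _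
  have hAμ : μ.real A ≤ 2 / n := by
    rw [hA_def, Measure.real, measure_toMeasurable]
    exact real_not_isConcentrated_le hn
  have hUp := measurePreserving_mulVec_stdGaussianMeasure hU
  have hUi : MeasurePreserving (fun x => U.mulVec x i) μ (gaussianReal 0 1) :=
    (measurePreserving_eval_stdGaussianMeasure i).comp hUp
  have hcomp : ∀ {f : (Fin n → ℝ) → ℝ} {g : ℝ → ℝ}, MeasurePreserving f μ (gaussianReal 0 1) →
      Integrable g (gaussianReal 0 1) → Integrable (fun x => g (f x)) μ ∧
        ∫ x, g (f x) ∂μ = ∫ v, g v ∂(gaussianReal 0 1) := fun {f g} hf hg =>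
    ⟨hf.integrable_comp_of_integrable hg, by
      rw [← hf.map_eq, integral_map hf.aemeasurable (hf.map_eq ▸ hg.aestronglyMeasurable)]⟩
  obtain ⟨i1, e1⟩ := hcomp hUi (integrable_coordMajorant n)
  obtain ⟨i2, e2⟩ := hcomp hUi integrable_exp_sq_div_four
  have i3 : Integrable (fun x => A.indicator (1 : (Fin n → ℝ) → ℝ) x) μ :=
    (integrable_const (1 : ℝ)).indicator hAm
  have i4 : Integrable (fun x => A.indicator (1 : (Fin n → ℝ) → ℝ) (U.mulVec x)) μ :=
    hUp.integrable_comp_of_integrable i3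
  have e3 : ∫ x, A.indicator (1 : (Fin n → ℝ) → ℝ) x ∂μ = μ.real A := integral_indicator_one hAm
  have e4 : ∫ x, A.indicator (1 : (Fin n → ℝ) → ℝ) (U.mulVec x) ∂μ = μ.real A := by
    have h := integral_map (f := fun x => A.indicator (1 : (Fin n → ℝ) → ℝ) x) hUp.aemeasurable
      (hUp.map_eq.symm ▸ i3.aestronglyMeasurable)
    rw [hUp.map_eq] at h
    exact h.symm.trans e3
  have i5 : Integrable (fun x => ∑ j, Real.exp (x j ^ 2 / 4)) μ := integrable_finsetSum _
    fun j _ => (hcomp (measurePreserving_eval_stdGaussianMeasure j) integrable_exp_sq_div_four).1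
  have e5 : ∫ x, ∑ j, Real.exp (x j ^ 2 / 4) ∂μ
      = n * ∫ v, Real.exp (v ^ 2 / 4) ∂(gaussianReal 0 1) := by
    rw [integral_finsetSum _ fun j _ =>
      (hcomp (measurePreserving_eval_stdGaussianMeasure j) integrable_exp_sq_div_four).1,
      Finset.sum_congr rfl fun j _ =>
      (hcomp (measurePreserving_eval_stdGaussianMeasure j) integrable_exp_sq_div_four).2]
    simp
  have i34 : Integrable (fun x => 64 * Real.log n *
      (A.indicator (1 : (Fin n → ℝ) → ℝ) x + A.indicator 1 (U.mulVec x))) μ :=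
    (i3.add i4).const_mul _
  have i25 : Integrable (fun x => 16 / (n : ℝ) ^ 2 *
      (Real.exp ((U.mulVec x i) ^ 2 / 4) + ∑ j, Real.exp (x j ^ 2 / 4))) μ :=
    (i2.add i5).const_mul _
  have i134 : Integrable (fun x => coordMajorant n (U.mulVec x i) + 64 * Real.log n *
      (A.indicator (1 : (Fin n → ℝ) → ℝ) x + A.indicator 1 (U.mulVec x))) μ := i1.add i34
  refine (integral_mono_of_nonneg (Filter.Eventually.of_forall fun x => sq_nonneg _)
    (i134.add i25) (Filter.Eventually.of_forall fun x => zeta_sq_le hn U x i hA)).trans ?_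
  rw [Pi.add_def, integral_add i134 i25, integral_add i1 i34, integral_const_mul,
    integral_const_mul, integral_add i3 i4, integral_add i2 i5, e1, e2, e3, e4, e5]
  refine add_le_add (add_le_add (integral_coordMajorant_le hn) ?_) (le_of_eq (by ring))
  gcongr

theorem stmt14 :
    ∃ c : ℝ, 0 < c ∧ ∀ (n : ℕ), 2 ≤ n →
      ∀ U : Matrix (Fin n) (Fin n) ℝ, U * Uᵀ = 1 →
      ∀ i : Fin n,
        ∫ x, zeta U x i ^ 2 ∂(stdGaussianMeasure n) ≤ c * (Real.log n) ^ 2 / n := by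
  set K := ∫ v, Real.exp (v ^ 2 / 4) ∂(gaussianReal 0 1) with hK
  have hK0 : 0 ≤ K := integral_nonneg fun v => (Real.exp_pos _).le
  refine ⟨10 ^ 7 + 128 * K, by positivity, fun n hn U hU i => ?_⟩
  have hn1 : (1 : ℝ) < n := by exact_mod_cast hn
  have hn0 : (0 : ℝ) < n := by linarith
  have hL : 1 / 2 < Real.log n := by
    have h1 := Real.log_two_gt_d9
    have h2 : Real.log 2 ≤ Real.log n := Real.log_le_log two_pos (by exact_mod_cast hn)
    linarith
  refine (integral_zeta_sq_le hn hU i).trans ?_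
  rw [← hK]
  set L := Real.log n
  have h1 : 16 / (n : ℝ) ^ 2 * ((n + 1) * K) ≤ 32 * K / n := by
    rw [div_mul_eq_mul_div, div_le_div_iff₀ (by positivity) hn0]
    nlinarith [mul_nonneg (mul_nonneg hK0 hn0.le) (sub_nonneg.2 hn1.le)]
  have h2 : 10 ^ 4 * (L / n) * (1 + 2 * (1 + L)) + 64 * L * (2 * (10 ^ 4 * L / n))
      + 64 * L * (2 / n + 2 / n) + 32 * K / n
      = (10 ^ 4 * L * (3 + 2 * L) + 128 * 10 ^ 4 * L ^ 2 + 256 * L + 32 * K) / n := by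
    field_simp
    ring
  refine (add_le_add_right h1 _).trans (h2.le.trans ?_)
  gcongr
  have h3 : L ≤ 2 * L ^ 2 := by nlinarith
  have h4 : 1 ≤ 4 * L ^ 2 := by nlinarith
  nlinarith [mul_le_mul_of_nonneg_left h4 hK0]
end

section
/- Theorem (Theorem 1.3): There is an absolute constant c such that for every n × n orthogonal matrix U there exist positive semidefinite n × n matrices A_σ, σ ∈ Sₙ, with Σ_σ A_σ = I, such that for A = Σ_σ A_σ σ (usual matrix products, σ identified with its permutation matrix), one has ‖U − A‖_∞ ≤ c (ln n)/√n and ‖U − A‖_F ≤ c ln n. -/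
open MeasureTheory Matrix

section

open ProbabilityTheory Set Filter Topology

lemma gaussianReal_real_Ici_le {u : ℝ} (hu : 0 ≤ u) :
    (gaussianReal 0 1).real (Ici u) ≤ Real.exp (-u ^ 2 / 2) := by
  have h := measure_ge_le_exp_mul_mgf (μ := gaussianReal 0 1) (X := id) u hu
    (integrable_exp_mul_gaussianReal u)
  rw [mgf_id_gaussianReal, ← Real.exp_add] at h
  refine h.trans (Real.exp_le_exp.2 ?_)
  simp only [NNReal.coe_one]
  nlinarith

lemma gaussianReal_real_Iic_le {u : ℝ} (hu : u ≤ 0) :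
    (gaussianReal 0 1).real (Iic u) ≤ Real.exp (-u ^ 2 / 2) := by
  have h := measure_le_le_exp_mul_mgf (μ := gaussianReal 0 1) (X := id) u hu
    (integrable_exp_mul_gaussianReal u)
  rw [mgf_id_gaussianReal, ← Real.exp_add] at h
  refine h.trans (Real.exp_le_exp.2 ?_)
  simp only [NNReal.coe_one]
  nlinarith

lemma exp_le_gaussianPDFReal (u : ℝ) :
    Real.exp (-u ^ 2 / 2) ≤ 3 * gaussianPDFReal 0 1 u := by
  have h : Real.sqrt (2 * Real.pi) ≤ 3 := by
    rw [Real.sqrt_le_left (by norm_num)]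
    nlinarith [Real.pi_lt_d2]
  have h0 : 0 < Real.sqrt (2 * Real.pi) := by positivity
  have he : 0 < Real.exp (-u ^ 2 / 2) := Real.exp_pos _
  have h1 : 1 ≤ 3 * (Real.sqrt (2 * Real.pi))⁻¹ := by
    rw [← div_eq_mul_inv, le_div_iff₀ h0]; linarith
  simp only [gaussianPDFReal, NNReal.coe_one, mul_one, sub_zero]
  nlinarith

lemma gaussianReal_real_Ioc (s t : ℝ) (hst : s ≤ t) :
    (gaussianReal 0 1).real (Ioc s t) =
      (gaussianReal 0 1).real (Iic t) - (gaussianReal 0 1).real (Iic s) := by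
  have h : Ioc s t = Iic t \ Iic s := by ext; simp [and_comm]
  rw [h, measureReal_sdiff (Iic_subset_Iic.2 hst) measurableSet_Iic]

/-- Away from the tails the Gaussian distribution function increases linearly. -/
lemma sub_mul_min_le_gaussianReal_Ioc {s t : ℝ} (hst : s ≤ t) :
    (t - s) * min ((gaussianReal 0 1).real (Iic s)) (1 - (gaussianReal 0 1).real (Iic t)) ≤
      3 * (gaussianReal 0 1).real (Ioc s t) := by
  set q := min ((gaussianReal 0 1).real (Iic s)) (1 - (gaussianReal 0 1).real (Iic t)) with hq
  have key : ∀ u ∈ Ioc s t, q / 3 ≤ gaussianPDFReal 0 1 u := by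
    intro u hu
    suffices q ≤ Real.exp (-u ^ 2 / 2) by linarith [exp_le_gaussianPDFReal u]
    rcases le_total u 0 with h | h
    · refine (min_le_left _ _).trans (le_trans ?_ (gaussianReal_real_Iic_le h))
      exact measureReal_mono (Iic_subset_Iic.2 hu.1.le)
    · refine (min_le_right _ _).trans (le_trans ?_ (gaussianReal_real_Ici_le h))
      rw [← probReal_compl_eq_one_sub measurableSet_Iic, compl_Iic]
      exact measureReal_mono ((Ioi_subset_Ioi hu.2).trans Ioi_subset_Ici_self)
  have hfint : ∫ _ in Ioc s t, q / 3 ≤ ∫ u in Ioc s t, gaussianPDFReal 0 1 u :=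
    setIntegral_mono_on (by simp) (integrable_gaussianPDFReal 0 1).integrableOn
      measurableSet_Ioc key
  have heq : (gaussianReal 0 1).real (Ioc s t) = ∫ u in Ioc s t, gaussianPDFReal 0 1 u := by
    rw [measureReal_def, gaussianReal_apply_eq_integral 0 one_ne_zero, ENNReal.toReal_ofReal]
    exact integral_nonneg fun u => gaussianPDFReal_nonneg 0 1 u
  rw [heq]
  simp only [integral_const, MeasurableSet.univ, measureReal_restrict_apply, univ_inter,
    Real.volume_real_Ioc_of_le hst, smul_eq_mul] at hfint
  linarith

lemma exists_gaussianReal_Iic_eq {p : ℝ} (h0 : 0 < p) (h1 : p < 1) :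
    ∃ t, (gaussianReal 0 1).real (Iic t) = p := by
  have := nullSingletonClass_gaussianReal (μ := 0) (v := 1) one_ne_zero
  have hc : Continuous (cdf (gaussianReal 0 1)) := by
    rw [continuous_iff_continuousAt]
    intro x
    refine (cdf (gaussianReal 0 1)).mono.continuousAt_iff_leftLim_eq_rightLim.2 ?_
    rw [StieltjesFunction.rightLim_eq]
    have h := StieltjesFunction.measure_singleton (cdf (gaussianReal 0 1)) x
    rw [measure_cdf, measure_singleton] at h
    have h2 := ENNReal.ofReal_eq_zero.1 h.symm
    have := (cdf (gaussianReal 0 1)).mono.leftLim_le (le_refl x)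
    linarith
  obtain ⟨t, ht⟩ := mem_range_of_exists_le_of_exists_ge hc
    ((tendsto_cdf_atBot (gaussianReal 0 1)).eventually_le_const h0).exists
    ((tendsto_cdf_atTop (gaussianReal 0 1)).eventually_const_le h1).exists
  exact ⟨t, by rw [← cdf_eq_real, ht]⟩

/-- The standard Gaussian measure on coordinate space. -/
noncomputable abbrev gaussianPi (n : ℕ) : Measure (Fin n → ℝ) :=
  Measure.pi fun _ => gaussianReal 0 1

/-- The standard Gaussian measure is invariant under orthogonal transformations. -/
lemma measurePreserving_mulVec_gaussianPi {n : ℕ} {V : Matrix (Fin n) (Fin n) ℝ}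
    (hV : Vᵀ * V = 1) :
    MeasurePreserving (fun x => V *ᵥ x) (gaussianPi n) (gaussianPi n) := by
  let li : EuclideanSpace ℝ (Fin n) →ₗᵢ[ℝ] EuclideanSpace ℝ (Fin n) :=
    ⟨Matrix.toEuclideanLin V, fun x => by
      rw [← sq_eq_sq₀ (norm_nonneg _) (norm_nonneg _), EuclideanSpace.real_norm_sq_eq,
        EuclideanSpace.real_norm_sq_eq]
      have h : (V *ᵥ x.ofLp) ⬝ᵥ (V *ᵥ x.ofLp) = x.ofLp ⬝ᵥ x.ofLp := by
        rw [Matrix.dotProduct_mulVec, Matrix.vecMul_mulVec, hV, Matrix.vecMul_one]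
      simpa [dotProduct, sq] using h⟩
  have hmap := stdGaussian_map (li.toLinearIsometryEquiv rfl)
  rw [← map_pi_eq_stdGaussian, Measure.map_map (by fun_prop) (by fun_prop)] at hmap
  refine ⟨(Continuous.matrix_mulVec continuous_const continuous_id).measurable, ?_⟩
  have h2 := congrArg (Measure.map (WithLp.ofLp : EuclideanSpace ℝ (Fin n) → Fin n → ℝ)) hmap
  rw [Measure.map_map (by fun_prop) (by fun_prop), Measure.map_map (by fun_prop) (by fun_prop)]
    at h2
  simpa [Function.comp_def, li] using h2

lemma integral_exp_mul_indicator_sub_le {α : Type*} [MeasurableSpace α] (μ : Measure α)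
    [IsProbabilityMeasure μ] {S : Set α} (hS : MeasurableSet S) {s : ℝ} (hs : |s| ≤ 1) :
    ∫ x, Real.exp (s * (S.indicator 1 x - μ.real S)) ∂μ ≤
      Real.exp (s ^ 2 * (μ.real S * (1 - μ.real S))) := by
  set p := μ.real S with hp
  have hp0 : 0 ≤ p := measureReal_nonneg
  have hp1 : p ≤ 1 := measureReal_le_one
  have bound : ∀ u : ℝ, |u| ≤ 1 → Real.exp (s * u) ≤ 1 + s * u + s ^ 2 * u ^ 2 := by
    intro u hu
    have h : |s * u| ≤ 1 := by
      rw [abs_mul]; exact mul_le_one₀ hs (abs_nonneg _) hu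
    have := (abs_le.1 (Real.abs_exp_sub_one_sub_id_le h)).2
    nlinarith
  have b1 := bound (1 - p) (abs_le.2 ⟨by linarith, by linarith⟩)
  have b0 := bound (-p) (abs_le.2 ⟨by linarith, by linarith⟩)
  have heq : (fun x => Real.exp (s * (S.indicator 1 x - p))) =
      fun x => Real.exp (s * (-p)) +
        S.indicator (fun _ => Real.exp (s * (1 - p)) - Real.exp (s * (-p))) x := by
    funext x
    by_cases hx : x ∈ S <;> simp [hx]
  rw [heq, integral_add (integrable_const _) ((integrable_const _).indicator hS),
    integral_indicator hS]
  simp only [integral_const, probReal_univ, smul_eq_mul, one_mul, measureReal_restrict_apply,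
    MeasurableSet.univ, univ_inter, ← hp]
  have h3 := Real.add_one_le_exp (s ^ 2 * (p * (1 - p)))
  nlinarith

lemma measureReal_le_sum_indicator_sub_le {α : Type*} [MeasurableSpace α] (μ : Measure α)
    [IsProbabilityMeasure μ] {S : Set α} (hS : MeasurableSet S) (n : ℕ) {L V ε : ℝ}
    (hL : 0 < L) (hLV : L ≤ V) (hV : n * (μ.real S * (1 - μ.real S)) ≤ V) (hε : |ε| = 1) :
    (Measure.pi fun _ : Fin n => μ).real
      {x | 3 * √(L * V) ≤ ε * ∑ i, (S.indicator 1 (x i) - μ.real S)} ≤ Real.exp (-2 * L) := by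
  have hV0 : 0 < V := hL.trans_le hLV
  set s := √(L / V) with hs
  have hs0 : 0 ≤ s := Real.sqrt_nonneg _
  have hs1 : s ≤ 1 := Real.sqrt_le_one.2 ((div_le_one hV0).2 hLV)
  have hsε : |s * ε| ≤ 1 := by rw [abs_mul, hε, abs_of_nonneg hs0]; simpa
  have hs2 : s ^ 2 * V = L := by
    rw [hs, Real.sq_sqrt (by positivity)]; field_simp
  have hsV : s * √(L * V) = L := by
    rw [hs, ← Real.sqrt_mul (by positivity), show L / V * (L * V) = L ^ 2 by field_simp,
      Real.sqrt_sq hL.le]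
  have hε2 : ε ^ 2 = 1 := by rw [← sq_abs, hε, one_pow]
  have hm : Measurable fun x => Real.exp (s * ε * (S.indicator 1 x - μ.real S)) := by
    have : Measurable (S.indicator (1 : α → ℝ)) := measurable_one.indicator hS
    fun_prop
  have hi : Integrable (fun x => Real.exp (s * ε * (S.indicator 1 x - μ.real S))) μ := by
    refine Integrable.of_bound hm.aestronglyMeasurable (Real.exp 1) (ae_of_all _ fun x => ?_)
    rw [Real.norm_of_nonneg (Real.exp_pos _).le, Real.exp_le_exp]
    refine (le_abs_self _).trans ?_
    rw [abs_mul]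
    refine mul_le_one₀ hsε (abs_nonneg _) ?_
    have hp0 : 0 ≤ μ.real S := measureReal_nonneg
    have hp1 : μ.real S ≤ 1 := measureReal_le_one
    by_cases hx : x ∈ S <;> simp [hx, abs_le] <;> linarith
  have hexp : (fun x : Fin n → α =>
      Real.exp (s * (ε * ∑ i, (S.indicator 1 (x i) - μ.real S)))) =
      fun x => ∏ i, Real.exp (s * ε * (S.indicator 1 (x i) - μ.real S)) := by
    funext x
    rw [← Real.exp_sum, ← Finset.mul_sum, mul_assoc]
  have h := measure_ge_le_exp_mul_mgf (μ := Measure.pi fun _ : Fin n => μ)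
    (X := fun x => ε * ∑ i, (S.indicator 1 (x i) - μ.real S)) (3 * √(L * V)) hs0
    (by rw [hexp]; exact Integrable.fintype_prod fun _ => hi)
  refine h.trans ?_
  rw [mgf, hexp, integral_fintype_prod_eq_pow
    (fun a => Real.exp (s * ε * (S.indicator 1 a - μ.real S))), Fintype.card_fin]
  calc _ ≤ Real.exp (-s * (3 * √(L * V))) *
        Real.exp ((s * ε) ^ 2 * (μ.real S * (1 - μ.real S))) ^ n := by
        refine mul_le_mul_of_nonneg_left (pow_le_pow_left₀
          (integral_nonneg fun _ => (Real.exp_pos _).le) ?_ n) (Real.exp_pos _).le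
        exact integral_exp_mul_indicator_sub_le μ hS hsε
    _ ≤ Real.exp (-2 * L) := by
        rw [← Real.exp_nat_mul, ← Real.exp_add, Real.exp_le_exp, mul_pow, hε2]
        nlinarith [sq_nonneg s]

/-- A Bernstein-type bound for the number of coordinates lying in a given set. -/
lemma measureReal_lt_abs_card_sub_le {α : Type*} [MeasurableSpace α] (μ : Measure α)
    [IsProbabilityMeasure μ] {S : Set α} [DecidablePred (· ∈ S)] (hS : MeasurableSet S) (n : ℕ)
    {L V : ℝ} (hL : 0 < L) (hLV : L ≤ V) (hV : n * (μ.real S * (1 - μ.real S)) ≤ V) :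
    (Measure.pi fun _ : Fin n => μ).real
      {x | 3 * √(L * V) < |(Finset.card {i | x i ∈ S} : ℝ) - n * μ.real S|} ≤
      2 * Real.exp (-2 * L) := by
  have hsum : ∀ x : Fin n → α, ∑ i, (S.indicator 1 (x i) - μ.real S) =
      (Finset.card {i | x i ∈ S} : ℝ) - n * μ.real S := by
    intro x
    simp [Finset.sum_sub_distrib, Set.indicator_apply]
  have h1 := measureReal_le_sum_indicator_sub_le μ hS n hL hLV hV (ε := 1) (by simp)
  have h2 := measureReal_le_sum_indicator_sub_le μ hS n hL hLV hV (ε := -1) (by simp)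
  refine (measureReal_mono (fun x hx => ?_) (by finiteness)).trans
    ((measureReal_union_le _ _).trans (add_le_add h1 h2)) |>.trans (by linarith)
  simp only [hsum, mem_union, mem_ofPred_eq] at hx ⊢
  rcases lt_abs.1 hx with h | h
  · left; linarith
  · right; linarith

/-- The permutation `σ` for which `x ∘ σ` and `y` are sorted in the same order. -/
noncomputable def rankMatch {n : ℕ} (x y : Fin n → ℝ) : Equiv.Perm (Fin n) :=
  (Tuple.sort y).symm.trans (Tuple.sort x)

lemma rankMatch_le {n : ℕ} {x y : Fin n → ℝ} {a b : ℝ} {j : Fin n}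
    (h : Finset.card {i | y i ≤ a} ≤ Finset.card {i | x i ≤ b}) (hj : y j ≤ a) :
    x (rankMatch x y j) ≤ b := by
  have key : ∀ (z : Fin n → ℝ) (c : ℝ) (k : Fin n),
      (k : ℕ) < Finset.card {i | z i ≤ c} ↔ z (Tuple.sort z k) ≤ c := by
    intro z c k
    rw [← Function.comp_apply (f := z),
      ← Tuple.lt_card_le_iff_apply_le_of_monotone (Tuple.monotone_sort z)]
    rw [← Finset.card_map (s := Finset.univ.filter fun i => (z ∘ Tuple.sort z) i ≤ c)
      (Tuple.sort z).toEmbedding]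
    congr! 2
    ext i
    simp [Finset.mem_map_equiv]
  set k := (Tuple.sort y).symm j with hk
  have h1 : (k : ℕ) < Finset.card {i | y i ≤ a} := by
    rw [key, hk, Equiv.apply_symm_apply]; exact hj
  exact (key x b k).1 (h1.trans_le h)

lemma rankMatch_symm {n : ℕ} (x y : Fin n → ℝ) :
    (rankMatch x y).symm = rankMatch y x := rfl

lemma lt_rankMatch {n : ℕ} {x y : Fin n → ℝ} {a b : ℝ} {j : Fin n}
    (h : Finset.card {i | x i ≤ b} ≤ Finset.card {i | y i ≤ a}) (hj : a < y j) :
    b < x (rankMatch x y j) := by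
  by_contra! hc
  have := rankMatch_le h hc
  rw [← rankMatch_symm, Equiv.symm_apply_apply] at this
  exact absurd hj this.not_gt

lemma measurableSet_rankMatch_eq {n : ℕ} {α : Type*} [MeasurableSpace α]
    {X Y : α → Fin n → ℝ} (hX : Measurable X) (hY : Measurable Y) (σ : Equiv.Perm (Fin n)) :
    MeasurableSet {a | rankMatch (X a) (Y a) = σ} := by
  have hsort : ∀ Z : α → Fin n → ℝ, Measurable Z → ∀ τ : Equiv.Perm (Fin n),
      MeasurableSet {a | Tuple.sort (Z a) = τ} := by
    intro Z hZ τ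
    have hZi : ∀ i, Measurable fun a => Z a i := fun i => (measurable_pi_apply i).comp hZ
    have h : {a | Tuple.sort (Z a) = τ} = {a | (∀ i j, i ≤ j → Z a (τ i) ≤ Z a (τ j)) ∧
        ∀ i j, i < j → Z a (τ i) = Z a (τ j) → τ i < τ j} := by
      ext a
      simp only [mem_ofPred_eq, eq_comm (a := Tuple.sort (Z a)), Tuple.eq_sort_iff]
      rfl
    rw [h]
    simp only [ofPred_and, ofPred_forall]
    refine MeasurableSet.inter
      (.iInter fun i => .iInter fun j => .iInter fun _ => measurableSet_le (hZi _) (hZi _))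
      (.iInter fun i => .iInter fun j => .iInter fun _ => ?_)
    by_cases hτ : τ i < τ j
    · simp [hτ]
    · simp only [hτ, imp_false]
      exact (measurableSet_eq_fun (hZi _) (hZi _)).compl
  have h : {a | rankMatch (X a) (Y a) = σ} =
      ⋃ τ : Equiv.Perm (Fin n),
        {a | Tuple.sort (Y a) = τ} ∩ {a | Tuple.sort (X a) = τ.trans σ} := by
    ext a
    simp only [mem_iUnion, mem_inter_iff, mem_ofPred_eq, exists_eq_left', rankMatch]
    constructor
    · rintro rfl; ext; simp
    · intro h; rw [h]; ext; simp
  rw [h]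
  exact .iUnion fun τ => (hsort Y hY τ).inter (hsort X hX _)
/-- Two counting functions that are both close to the identity cross within a short window. -/
lemma exists_window {n m : ℕ} {L : ℝ} (hL : 1 ≤ L) {Nx Ny : ℕ → ℕ}
    (hm : 484 * L ≤ min (m : ℝ) (n - m))
    (hx : ∀ l : ℕ, L ≤ min (l : ℝ) (n - l) → |(Nx l : ℝ) - l| ≤ 3 * √(L * min (l : ℝ) (n - l)))
    (hy : ∀ l : ℕ, L ≤ min (l : ℝ) (n - l) → |(Ny l : ℝ) - l| ≤ 3 * √(L * min (l : ℝ) (n - l))) :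
    ∃ a b : ℕ, 0 < a ∧ a ≤ m ∧ m + 1 ≤ b ∧ b < n ∧ Nx a ≤ Ny m ∧ Ny (m + 1) ≤ Nx b ∧
      (b - a : ℝ) ≤ 22 * √(L * min (m : ℝ) (n - m)) ∧
      min (m : ℝ) (n - m) / 2 ≤ min (a : ℝ) (n - b) := by
  set μ := min (m : ℝ) (n - m) with hμ
  set r := √(L * μ) with hr
  have hμ0 : 0 < μ := by linarith
  have hr2 : r ^ 2 = L * μ := Real.sq_sqrt (by positivity)
  have hr0 : 0 ≤ r := Real.sqrt_nonneg _
  have hr1 : 4 ≤ r := by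
    refine Real.le_sqrt_of_sq_le ?_
    nlinarith
  have hrμ : 22 * r ≤ μ := by
    rw [← abs_of_nonneg hμ0.le, ← abs_of_nonneg (by positivity : 0 ≤ 22 * r), ← sq_le_sq]
    nlinarith
  obtain ⟨d, hd1, hd2⟩ : ∃ d : ℕ, 9 * r ≤ d ∧ (d : ℝ) < 9 * r + 1 :=
    ⟨⌈9 * r⌉₊, Nat.le_ceil _, Nat.ceil_lt_add_one (by positivity)⟩
  have hμm : μ ≤ m := min_le_left _ _
  have hμn : μ ≤ n - m := min_le_right _ _
  have hdm : d < m := by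
    have : (d : ℝ) < m := by linarith
    exact_mod_cast this
  have hdn : m + 1 + d < n := by
    have : (m : ℝ) + 1 + d < n := by linarith
    exact_mod_cast this
  have near : ∀ l : ℕ, (m : ℝ) - d ≤ l → (l : ℝ) ≤ m + 1 + d →
      L ≤ min (l : ℝ) (n - l) ∧ 3 * √(L * min (l : ℝ) (n - l)) ≤ 9 / 2 * r := by
    intro l h1 h2
    refine ⟨le_min (by linarith) (by linarith), ?_⟩
    have hle : min (l : ℝ) (n - l) ≤ 2 * μ := by
      rcases min_choice (m : ℝ) (n - m) with h | h <;> rw [← hμ] at h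
      · exact (min_le_left _ _).trans (by linarith)
      · exact (min_le_right _ _).trans (by linarith)
    have : √(L * min (l : ℝ) (n - l)) ≤ 3 / 2 * r := by
      refine Real.sqrt_le_iff.2 ⟨by positivity, ?_⟩
      nlinarith
    linarith
  have ca : ((m - d : ℕ) : ℝ) = m - d := by rw [Nat.cast_sub hdm.le]
  have cb : ((m + 1 + d : ℕ) : ℝ) = m + 1 + d := by push_cast; ring
  have cm : ((m + 1 : ℕ) : ℝ) = m + 1 := by push_cast; ring
  obtain ⟨a1, a2⟩ := near (m - d) (by linarith) (by linarith)
  obtain ⟨b1, b2⟩ := near (m + 1 + d) (by linarith) (by linarith)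
  obtain ⟨e1, e2⟩ := near m (by linarith) (by linarith)
  obtain ⟨f1, f2⟩ := near (m + 1) (by linarith) (by linarith)
  have xa := abs_le.1 (hx _ a1)
  have xb := abs_le.1 (hx _ b1)
  have ye := abs_le.1 (hy _ e1)
  have yf := abs_le.1 (hy _ f1)
  refine ⟨m - d, m + 1 + d, by omega, by omega, by omega, hdn, ?_, ?_, ?_, ?_⟩
  · have : (Nx (m - d) : ℝ) ≤ Ny m := by linarith [xa.2, ye.1]
    exact_mod_cast this
  · have : (Ny (m + 1) : ℝ) ≤ Nx (m + 1 + d) := by linarith [xb.1, yf.2]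
    exact_mod_cast this
  · linarith
  · exact le_min (by linarith) (by linarith)

/-- Between the quantiles enclosing a window, the squared length is controlled by the depth. -/
lemma sq_le_of_mem_window {n a b : ℕ} {L μ s t y z : ℝ} (hL : 0 < L) (hμ : 0 < μ)
    (hn : 0 < n) (hs : (gaussianReal 0 1).real (Iic s) = a / n)
    (ht : (gaussianReal 0 1).real (Iic t) = b / n)
    (hab : (b - a : ℝ) ≤ 22 * √(L * μ)) (hμab : μ / 2 ≤ min (a : ℝ) (n - b))
    (hy : y ∈ Ioc s t) (hz : z ∈ Ioc s t) : (y - z) ^ 2 ≤ 132 ^ 2 * (L / μ) := by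
  have hst : s ≤ t := hy.1.le.trans hy.2
  have hn' : (0 : ℝ) < n := by exact_mod_cast hn
  have h := sub_mul_min_le_gaussianReal_Ioc hst
  rw [gaussianReal_real_Ioc s t hst, hs, ht] at h
  have hmin : μ / 2 / n ≤ min ((a : ℝ) / n) (1 - b / n) := by
    refine le_min ?_ ?_
    · gcongr; exact hμab.trans (min_le_left _ _)
    · rw [one_sub_div hn'.ne']; gcongr; exact hμab.trans (min_le_right _ _)
  have h2 : (t - s) * (μ / 2 / n) ≤ 3 * ((b - a) / n) := by
    rw [sub_div]
    exact (mul_le_mul_of_nonneg_left hmin (sub_nonneg.2 hst)).trans h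
  have h3 : (t - s) * μ ≤ 132 * √(L * μ) := by
    have : (t - s) * μ ≤ 6 * (b - a) := by
      field_simp at h2
      linarith
    linarith
  have hyz : |y - z| ≤ t - s := abs_le.2 ⟨by linarith [hy.1, hz.2], by linarith [hy.2, hz.1]⟩
  have h4 : ((t - s) * μ) ^ 2 ≤ 132 ^ 2 * (L * μ) := by
    rw [← Real.sq_sqrt (by positivity : 0 ≤ L * μ), ← mul_pow]
    exact pow_le_pow_left₀ (mul_nonneg (sub_nonneg.2 hst) hμ.le) h3 2
  calc (y - z) ^ 2 ≤ (t - s) ^ 2 := by rw [← sq_abs]; gcongr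
    _ ≤ 132 ^ 2 * (L / μ) := by
      rw [← mul_div_assoc, le_div_iff₀ hμ]
      refine le_of_mul_le_mul_right ?_ hμ
      linarith

/-- The squares of Gaussian variables exceed `16 * L` by a negligible amount. -/
lemma exists_sq_le_add {L : ℝ} (hL : 1 ≤ L) :
    ∃ h : ℝ → ℝ, Integrable h (gaussianReal 0 1) ∧ (∀ x, 0 ≤ h x) ∧
      (∀ x, x ^ 2 ≤ 16 * L + h x) ∧ ∫ x, h x ∂gaussianReal 0 1 ≤ 4 * Real.exp (-2 * L) := by
  set r := 4 * √L with hr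
  have hr2 : r ^ 2 = 16 * L := by rw [hr, mul_pow, Real.sq_sqrt (by linarith)]; norm_num
  have hr4 : 4 ≤ r := by
    have : 1 ≤ √L := Real.one_le_sqrt.2 hL
    linarith
  have hfint := fun t => integrable_exp_mul_gaussianReal (μ := 0) (v := 1) t
  have hval : ∀ t, ∫ x, Real.exp (t * x) ∂gaussianReal 0 1 = Real.exp (t ^ 2 / 2) := by
    intro t
    simpa [mgf] using congrFun (mgf_id_gaussianReal (μ := 0) (v := 1)) t
  refine ⟨fun x => 2 * Real.exp (-(r - 1) * r) * (Real.exp (r * x) + Real.exp (-r * x)),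
    ((hfint r).add (hfint (-r))).const_mul _, fun x => by positivity, fun x => ?_, ?_⟩
  · have key : ∀ u : ℝ, 0 ≤ u →
        u ^ 2 ≤ r ^ 2 + 2 * Real.exp (-(r - 1) * r) * Real.exp (r * u) := by
      intro u hu
      rcases le_total u r with h | h
      · have : u ^ 2 ≤ r ^ 2 := pow_le_pow_left₀ hu h 2
        have : 0 ≤ 2 * Real.exp (-(r - 1) * r) * Real.exp (r * u) := by positivity
        linarith
      · have h1 := Real.quadratic_le_exp_of_nonneg hu
        have h2 : Real.exp u ≤ Real.exp (-(r - 1) * r) * Real.exp (r * u) := by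
          rw [← Real.exp_add, Real.exp_le_exp]
          nlinarith
        nlinarith [sq_nonneg r]
    rw [← hr2]
    have hp := Real.exp_pos (-(r - 1) * r)
    rcases le_total 0 x with h | h
    · have := key x h
      have h3 := mul_pos hp (Real.exp_pos (-r * x))
      linarith
    · have := key (-x) (by linarith)
      have h3 := mul_pos hp (Real.exp_pos (r * x))
      rw [mul_neg, ← neg_mul, neg_sq] at this
      linarith
  · rw [integral_const_mul, integral_add (hfint r) (hfint (-r)), hval, hval, neg_sq]
    have h : Real.exp (-(r - 1) * r) * Real.exp (r ^ 2 / 2) ≤ Real.exp (-2 * L) := by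
      rw [← Real.exp_add, Real.exp_le_exp]
      nlinarith
    linarith

/-- Outside an event of small probability, the empirical distribution function of a Gaussian
vector is close to its mean at all prescribed quantiles. -/
lemma exists_card_le_quantile_close {n : ℕ} {L : ℝ} (hL : 0 < L) {t : ℕ → ℝ}
    (ht : ∀ l, 0 < l → l < n → (gaussianReal 0 1).real (Iic (t l)) = l / n) :
    ∃ B : Set (Fin n → ℝ), MeasurableSet B ∧
      (gaussianPi n).real B ≤ n * (2 * Real.exp (-2 * L)) ∧
      ∀ x ∉ B, ∀ l : ℕ, L ≤ min (l : ℝ) (n - l) →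
        |(Finset.card {i | x i ≤ t l} : ℝ) - l| ≤ 3 * √(L * min (l : ℝ) (n - l)) := by
  have hpos : ∀ l : ℕ, L ≤ min (l : ℝ) (n - l) → 0 < l ∧ l < n := by
    intro l hl
    have h1 := hL.trans_le (hl.trans (min_le_left _ _))
    have h2 := hL.trans_le (hl.trans (min_le_right _ _))
    exact ⟨by exact_mod_cast h1, by exact_mod_cast (sub_pos.1 h2)⟩
  let D : ℕ → Set (Fin n → ℝ) := fun l =>
    {x | L ≤ min (l : ℝ) (n - l) ∧
      3 * √(L * min (l : ℝ) (n - l)) < |(Finset.card {i | x i ≤ t l} : ℝ) - l|}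
  have hcard : ∀ l : ℕ, Measurable fun x : Fin n → ℝ => (Finset.card {i | x i ≤ t l} : ℝ) := by
    intro l
    simp only [Finset.card_filter, Nat.cast_sum, Nat.cast_ite, Nat.cast_one, Nat.cast_zero]
    exact Finset.measurable_sum _ fun i _ => Measurable.ite
      (measurableSet_le (measurable_pi_apply i) measurable_const) measurable_const
      measurable_const
  have hDm : ∀ l, MeasurableSet (D l) := by
    intro l
    have h : Measurable fun x : Fin n → ℝ =>
        |((Finset.univ.filter fun i => x i ≤ t l).card : ℝ) - l| := by
      have := hcard l
      fun_prop
    exact (MeasurableSet.const _).inter (measurableSet_lt measurable_const h)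
  refine ⟨⋃ l ∈ Finset.range n, D l, Finset.measurableSet_biUnion _ fun l _ => hDm l, ?_, ?_⟩
  · refine (measureReal_biUnion_finset_le _ _).trans ?_
    calc _ ≤ ∑ l ∈ Finset.range n, 2 * Real.exp (-2 * L) := ?_
      _ = _ := by simp
    refine Finset.sum_le_sum fun l _ => ?_
    by_cases hl : L ≤ min (l : ℝ) (n - l)
    · obtain ⟨h0, h1⟩ := hpos l hl
      have hn : (0 : ℝ) < n := by exact_mod_cast h0.trans h1
      have hp := ht l h0 h1
      have hl0 : (0 : ℝ) ≤ l := Nat.cast_nonneg l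
      have hl1 : (l : ℝ) ≤ n := by exact_mod_cast h1.le
      have hp0 : 0 ≤ (l : ℝ) / n := by positivity
      have hp1 : (l : ℝ) / n ≤ 1 := (div_le_one hn).2 hl1
      have hnl : n * ((l : ℝ) / n) = l := by field_simp
      have hnl2 : n * (1 - (l : ℝ) / n) = n - l := by field_simp
      have h := measureReal_lt_abs_card_sub_le (gaussianReal 0 1)
        (measurableSet_Iic (a := t l)) n hL hl (by
          rw [hp]
          refine le_min ?_ ?_
          · nlinarith
          · nlinarith)
      refine (measureReal_mono (fun x hx => ?_) (by finiteness)).trans h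
      have := hx.2
      simpa [hp, hnl] using this
    · have : D l = ∅ := eq_empty_of_forall_notMem fun x hx => hl hx.1
      rw [this, measureReal_empty]; positivity
  · intro x hx l hl
    by_contra! hc
    exact hx (mem_biUnion (Finset.mem_coe.2 (Finset.mem_range.2 (hpos l hl).2)) ⟨hl, hc⟩)

lemma card_filter_not_depth_le (n : ℕ) {K : ℝ} (hK : 0 ≤ K) :
    (((Finset.range n).filter fun m : ℕ => ¬ K ≤ min (m : ℝ) (n - m)).card : ℝ) ≤
      2 * (K + 1) := by
  have hsub : (Finset.range n).filter (fun m : ℕ => ¬ K ≤ min (m : ℝ) (n - m)) ⊆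
      Finset.range ⌈K⌉₊ ∪ (Finset.range ⌈K⌉₊).image (fun k => n - k) := by
    intro m hm
    simp only [Finset.mem_filter, Finset.mem_range, le_min_iff, not_and_or, not_le,
      Finset.mem_union, Finset.mem_image] at hm ⊢
    obtain ⟨hmn, h | h⟩ := hm
    · left; exact Nat.lt_ceil.2 h
    · right
      refine ⟨n - m, Nat.lt_ceil.2 (by rw [Nat.cast_sub hmn.le]; exact h), by omega⟩
  have hcard : ((Finset.range n).filter fun m : ℕ => ¬ K ≤ min (m : ℝ) (n - m)).card ≤
      ⌈K⌉₊ + ⌈K⌉₊ := by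
    refine (Finset.card_le_card hsub).trans ((Finset.card_union_le _ _).trans ?_)
    refine add_le_add (by simp) (Finset.card_image_le.trans (by simp))
  have h1 := (Nat.ceil_lt_add_one hK).le
  have h2 : (((Finset.range n).filter fun m : ℕ => ¬ K ≤ min (m : ℝ) (n - m)).card : ℝ) ≤
      ⌈K⌉₊ + ⌈K⌉₊ := by exact_mod_cast hcard
  linarith

lemma sum_inv_depth_le (n : ℕ) {K : ℝ} (hK : 0 < K) :
    ∑ m ∈ (Finset.range n).filter (fun m : ℕ => K ≤ min (m : ℝ) (n - m)),
      (min (m : ℝ) (n - m))⁻¹ ≤ 2 * (1 + Real.log n) := by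
  have hH : ((harmonic n : ℚ) : ℝ) = ∑ m ∈ Finset.range n, ((m : ℝ) + 1)⁻¹ := by
    simp [harmonic]
  have hlog := harmonic_le_one_add_log n
  rw [hH] at hlog
  have hR : ∑ m ∈ Finset.range n, ((n : ℝ) - m)⁻¹ = ∑ m ∈ Finset.range n, ((m : ℝ) + 1)⁻¹ := by
    rw [← Finset.sum_range_reflect]
    refine Finset.sum_congr rfl fun m hm => ?_
    have := Finset.mem_range.1 hm
    congr 1
    rw [Nat.sub_sub, Nat.cast_sub (by omega)]
    push_cast; ring
  have hLft : ∑ m ∈ Finset.range n, (m : ℝ)⁻¹ ≤ ∑ m ∈ Finset.range n, ((m : ℝ) + 1)⁻¹ := by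
    cases n with
    | zero => simp
    | succ k =>
      rw [Finset.sum_range_succ', Finset.sum_range_succ]
      simp only [Nat.cast_add, Nat.cast_one, Nat.cast_zero, _root_.inv_zero]
      have : 0 ≤ ((k : ℝ) + 1)⁻¹ := by positivity
      linarith
  calc _ ≤ ∑ m ∈ (Finset.range n).filter (fun m : ℕ => K ≤ min (m : ℝ) (n - m)),
        ((m : ℝ)⁻¹ + ((n : ℝ) - m)⁻¹) := by
        refine Finset.sum_le_sum fun m hm => ?_
        have hm := (Finset.mem_filter.1 hm).2
        have h1 := inv_pos.2 (hK.trans_le (hm.trans (min_le_left _ _)))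
        have h2 := inv_pos.2 (hK.trans_le (hm.trans (min_le_right _ _)))
        rcases min_choice (m : ℝ) (n - m) with h | h <;> rw [h] <;> linarith
    _ ≤ ∑ m ∈ Finset.range n, ((m : ℝ)⁻¹ + ((n : ℝ) - m)⁻¹) := by
        refine Finset.sum_le_sum_of_subset_of_nonneg (Finset.filter_subset _ _) fun m hm _ => ?_
        have : (m : ℝ) ≤ n := by exact_mod_cast (Finset.mem_range.1 hm).le
        have := inv_nonneg.2 (sub_nonneg.2 this)
        positivity
    _ ≤ _ := by
        rw [Finset.sum_add_distrib, hR]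
        linarith

lemma measurePreserving_eval_gaussianPi {n : ℕ} (i : Fin n) :
    MeasurePreserving (fun x => x i) (gaussianPi n) (gaussianReal 0 1) :=
  measurePreserving_eval (fun _ => gaussianReal 0 1) i

lemma measurable_rankMatch_apply {n : ℕ} {V : Matrix (Fin n) (Fin n) ℝ} (j : Fin n) :
    Measurable fun x : Fin n → ℝ => x (rankMatch x (V *ᵥ x) j) := by
  have hV : Measurable fun x : Fin n → ℝ => V *ᵥ x :=
    (Continuous.matrix_mulVec continuous_const continuous_id).measurable
  have h : (fun x : Fin n → ℝ => x (rankMatch x (V *ᵥ x) j)) =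
      fun x => ∑ σ : Equiv.Perm (Fin n),
        {x | rankMatch x (V *ᵥ x) = σ}.indicator (fun x => x (σ j)) x := by
    funext x
    simp [Set.indicator_apply]
  rw [h]
  exact Finset.measurable_sum _ fun σ _ => (measurable_pi_apply _).indicator
    (measurableSet_rankMatch_eq measurable_id hV σ)

/-- Matching the coordinates of a Gaussian vector with those of its rotation by rank costs little
in each coordinate. -/
lemma integral_sq_sub_rankMatch_le {n : ℕ} {V : Matrix (Fin n) (Fin n) ℝ} (hV : Vᵀ * V = 1)
    (j : Fin n) :
    MemLp (fun x => (V *ᵥ x) j - x (rankMatch x (V *ᵥ x) j)) 2 (gaussianPi n) ∧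
      ∫ x, ((V *ᵥ x) j - x (rankMatch x (V *ᵥ x) j)) ^ 2 ∂gaussianPi n ≤
        100000 * (1 + Real.log n) ^ 2 / n := by
  have hn : 0 < n := j.pos
  have hn' : (0 : ℝ) < n := by exact_mod_cast hn
  have hn1 : (1 : ℝ) ≤ n := by exact_mod_cast hn
  set L := 1 + Real.log n with hLdef
  have hL : 1 ≤ L := by linarith [Real.log_nonneg hn1]
  have hL0 : 0 < L := by linarith
  have hexp : Real.exp (-2 * L) ≤ 1 / n ^ 2 := by
    rw [one_div, ← Real.exp_log hn', ← Real.exp_nat_mul, ← Real.exp_neg, Real.exp_le_exp,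
      hLdef]
    push_cast
    linarith
  have hquant : ∀ l : ℕ, ∃ t, 0 < l → l < n → (gaussianReal 0 1).real (Iic t) = l / n := by
    intro l
    by_cases h : 0 < l ∧ l < n
    · obtain ⟨t, ht⟩ := exists_gaussianReal_Iic_eq (p := (l : ℝ) / n)
        (div_pos (by exact_mod_cast h.1) hn') ((div_lt_one hn').2 (by exact_mod_cast h.2))
      exact ⟨t, fun _ _ => ht⟩
    · exact ⟨0, fun h1 h2 => absurd ⟨h1, h2⟩ h⟩
  choose t ht using hquant
  have htm : ∀ a b : ℕ, 0 < a → a ≤ b → b < n → t a ≤ t b := by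
    intro a b h0 hab hb
    rcases hab.eq_or_lt with rfl | hlt
    · rfl
    by_contra! hc
    have h1 := measureReal_mono (μ := gaussianReal 0 1) (Iic_subset_Iic.2 hc.le)
    rw [ht a h0 (by omega), ht b (by omega) hb, div_le_div_iff_of_pos_right hn'] at h1
    exact absurd (by exact_mod_cast h1 : b ≤ a) (by omega)
  obtain ⟨h, hfint, h0, hsq, hI⟩ := exists_sq_le_add hL
  obtain ⟨B, hB, hBμ, hBx⟩ := exists_card_le_quantile_close hL0 ht
  have hT := measurePreserving_mulVec_gaussianPi hV
  have hY : MeasurePreserving (fun x => (V *ᵥ x) j) (gaussianPi n) (gaussianReal 0 1) :=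
    (measurePreserving_eval_gaussianPi j).comp hT
  set B' := (fun x => V *ᵥ x) ⁻¹' B with hB'def
  have hB' : MeasurableSet B' := hT.measurable hB
  have hB'μ : (gaussianPi n).real B' = (gaussianPi n).real B :=
    hT.measureReal_preimage hB.nullMeasurableSet
  set M := (Finset.range n).filter (fun m : ℕ => 484 * L ≤ min (m : ℝ) (n - m)) with hM
  have hMpos : ∀ m ∈ M, 484 * L ≤ min (m : ℝ) (n - m) ∧ 0 < m ∧ m + 1 < n := by
    intro m hm
    have h1 := (Finset.mem_filter.1 hm).2
    have h2 := h1.trans (min_le_left _ _)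
    have h3 := h1.trans (min_le_right _ _)
    refine ⟨h1, ?_, ?_⟩
    · have : (0 : ℝ) < m := by linarith
      exact_mod_cast this
    · have : (m : ℝ) + 1 < n := by linarith
      exact_mod_cast this
  let C : ℕ → Set ℝ := fun m => Ioc (t m) (t (m + 1))
  have hCγ : ∀ m ∈ M, (gaussianReal 0 1).real (C m) = 1 / n := by
    intro m hm
    obtain ⟨-, h1, h2⟩ := hMpos m hm
    rw [gaussianReal_real_Ioc _ _ (htm _ _ h1 (by omega) h2), ht _ (by omega) h2,
      ht _ h1 (by omega)]
    push_cast; ring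
  have hCm : ∀ m, MeasurableSet (C m) := fun m => measurableSet_Ioc
  have hCdisj : (M : Set ℕ).PairwiseDisjoint C := by
    have hlt : ∀ a ∈ M, ∀ b ∈ M, a < b → Disjoint (C a) (C b) := by
      intro a ha b hb hab
      obtain ⟨-, h1, h2⟩ := hMpos a ha
      obtain ⟨-, h3, h4⟩ := hMpos b hb
      have := htm (a + 1) b (by omega) hab (by omega)
      exact Set.disjoint_left.2 fun u hu hu' => absurd (hu.2.trans this) hu'.1.not_ge
    intro a ha b hb hab
    rcases lt_or_gt_of_ne hab with h | h
    · exact hlt a ha b hb h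
    · exact (hlt b hb a ha h).symm
  set T := (⋃ m ∈ M, C m)ᶜ with hTdef
  have hTm : MeasurableSet T := (Finset.measurableSet_biUnion _ fun m _ => hCm m).compl
  have hTγ : (gaussianReal 0 1).real T ≤ 970 * L / n := by
    rw [hTdef, probReal_compl_eq_one_sub (Finset.measurableSet_biUnion _ fun m _ => hCm m),
      measureReal_biUnion_finset hCdisj fun m _ => hCm m, Finset.sum_congr rfl hCγ]
    have h1 := card_filter_not_depth_le n (K := 484 * L) (by positivity)
    have h2 := Finset.card_filter_add_card_filter_not (s := Finset.range n)
      (fun m : ℕ => 484 * L ≤ min (m : ℝ) (n - m))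
    rw [Finset.card_range] at h2
    have h3 : (M.card : ℝ) + (((Finset.range n).filter
      fun m : ℕ => ¬ 484 * L ≤ min (m : ℝ) (n - m)).card : ℝ) = n := by
      rw [← Nat.cast_add, h2]
    rw [Finset.sum_const, nsmul_eq_mul, mul_one_div, one_sub_div hn'.ne']
    gcongr
    linarith
  set w := fun x : Fin n → ℝ => (V *ᵥ x) j - x (rankMatch x (V *ᵥ x) j) with hw
  set Q := fun x : Fin n → ℝ => 2 * h ((V *ᵥ x) j) + 2 * ∑ i, h (x i) with hQ
  set E := fun x : Fin n → ℝ =>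
    ∑ m ∈ M, 132 ^ 2 * L * (min (m : ℝ) (n - m))⁻¹ * (C m).indicator 1 ((V *ᵥ x) j) +
      64 * L * T.indicator 1 ((V *ᵥ x) j) + 64 * L * B.indicator 1 x +
      64 * L * B'.indicator 1 x + Q x with hE
  have hQ0 : ∀ x, 0 ≤ Q x := fun x =>
    add_nonneg (mul_nonneg zero_le_two (h0 _))
      (mul_nonneg zero_le_two (Finset.sum_nonneg fun i _ => h0 _))
  have ind0 : ∀ {α : Type} (S : Set α) (a : α), (0 : ℝ) ≤ S.indicator 1 a := fun S a =>
    Set.indicator_nonneg (fun _ _ => zero_le_one) a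
  have hcoef : ∀ m ∈ M, 0 ≤ 132 ^ 2 * L * (min (m : ℝ) (n - m))⁻¹ := fun m hm => by
    have := (hMpos m hm).1
    have : 0 < min (m : ℝ) (n - m) := by linarith
    positivity
  have hsum0 : ∀ x : Fin n → ℝ, 0 ≤ ∑ m ∈ M,
      132 ^ 2 * L * (min (m : ℝ) (n - m))⁻¹ * (C m).indicator 1 ((V *ᵥ x) j) := fun x =>
    Finset.sum_nonneg fun m hm => mul_nonneg (hcoef m hm) (ind0 _ _)
  have hcrude : ∀ x, w x ^ 2 ≤ 64 * L + Q x := by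
    intro x
    have h1 := hsq ((V *ᵥ x) j)
    have h2 := hsq (x (rankMatch x (V *ᵥ x) j))
    have h3 : h (x (rankMatch x (V *ᵥ x) j)) ≤ ∑ i, h (x i) :=
      Finset.single_le_sum (f := fun i => h (x i)) (fun i _ => h0 _) (Finset.mem_univ _)
    simp only [hw, hQ]
    nlinarith [sq_nonneg ((V *ᵥ x) j + x (rankMatch x (V *ᵥ x) j))]
  have hwE : ∀ x, w x ^ 2 ≤ E x := by
    intro x
    have hs := hsum0 x
    have iT := mul_nonneg (by positivity : 0 ≤ 64 * L) (ind0 T ((V *ᵥ x) j))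
    have iB := mul_nonneg (by positivity : 0 ≤ 64 * L) (ind0 B x)
    have iB' := mul_nonneg (by positivity : 0 ≤ 64 * L) (ind0 B' x)
    have hc := hcrude x
    have hq := hQ0 x
    simp only [hE]
    by_cases hxB : x ∈ B
    · rw [Set.indicator_of_mem hxB] at iB ⊢
      simp only [Pi.one_apply] at iB ⊢
      linarith
    by_cases hxB' : x ∈ B'
    · rw [Set.indicator_of_mem hxB'] at iB' ⊢
      simp only [Pi.one_apply] at iB' ⊢
      linarith
    by_cases hxT : (V *ᵥ x) j ∈ T
    · rw [Set.indicator_of_mem hxT] at iT ⊢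
      simp only [Pi.one_apply] at iT ⊢
      linarith
    obtain ⟨m, hmM, hmC⟩ : ∃ m ∈ M, (V *ᵥ x) j ∈ C m := by
      simpa [hTdef] using hxT
    obtain ⟨hm, hm0, hmn⟩ := hMpos m hmM
    obtain ⟨a, b, ha, ham, hmb, hb, hNa, hNb, hab, hμ⟩ :=
      exists_window hL hm (hBx x hxB) (hBx (V *ᵥ x) hxB')
    have hz : x (rankMatch x (V *ᵥ x) j) ∈ Ioc (t a) (t b) :=
      ⟨lt_rankMatch hNa hmC.1, rankMatch_le hNb hmC.2⟩
    have hy : (V *ᵥ x) j ∈ Ioc (t a) (t b) :=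
      ⟨(htm a m ha ham (by omega)).trans_lt hmC.1, hmC.2.trans (htm (m + 1) b (by omega) hmb hb)⟩
    have hfin := sq_le_of_mem_window hL0 (by linarith) hn (ht a ha (by omega))
      (ht b (by omega) hb) hab hμ hy hz
    have hterm := Finset.single_le_sum (f := fun m : ℕ =>
      132 ^ 2 * L * (min (m : ℝ) (n - m))⁻¹ * (C m).indicator 1 ((V *ᵥ x) j))
      (fun m hm => mul_nonneg (hcoef m hm) (ind0 _ _)) hmM
    simp only [Set.indicator_of_mem hmC, Pi.one_apply, mul_one] at hterm
    rw [div_eq_mul_inv, ← mul_assoc] at hfin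
    simp only [hw]
    linarith
  have intInd : ∀ {S : Set (Fin n → ℝ)}, MeasurableSet S →
      Integrable (S.indicator (1 : (Fin n → ℝ) → ℝ)) (gaussianPi n) := fun hS =>
    (integrable_const (1 : ℝ)).indicator hS
  have intY : ∀ {S : Set ℝ}, MeasurableSet S →
      Integrable (fun x => S.indicator (1 : ℝ → ℝ) ((V *ᵥ x) j)) (gaussianPi n) := fun hS =>
    intInd (hY.measurable hS)
  have valInd : ∀ {S : Set (Fin n → ℝ)}, MeasurableSet S →
      ∫ x, S.indicator (1 : (Fin n → ℝ) → ℝ) x ∂gaussianPi n = (gaussianPi n).real S := fun hS =>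
    integral_indicator_one hS
  have valY : ∀ {S : Set ℝ}, MeasurableSet S →
      ∫ x, S.indicator (1 : ℝ → ℝ) ((V *ᵥ x) j) ∂gaussianPi n = (gaussianReal 0 1).real S :=
    fun hS => (valInd (hY.measurable hS)).trans (hY.measureReal_preimage hS.nullMeasurableSet)
  have inthY : Integrable (fun x => h ((V *ᵥ x) j)) (gaussianPi n) :=
    hY.integrable_comp_of_integrable hfint
  have inthx : ∀ i, Integrable (fun x : Fin n → ℝ => h (x i)) (gaussianPi n) := fun i =>
    (measurePreserving_eval_gaussianPi i).integrable_comp_of_integrable hfint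
  have valh : ∀ {f : (Fin n → ℝ) → ℝ}, MeasurePreserving f (gaussianPi n) (gaussianReal 0 1) →
      ∫ x, h (f x) ∂gaussianPi n ≤ 4 * Real.exp (-2 * L) := by
    intro f hf
    rw [← hf.map_eq, integral_map hf.measurable.aemeasurable
      (by rw [hf.map_eq]; exact hfint.aestronglyMeasurable)] at hI
    exact hI
  have intsumh : Integrable (fun x : Fin n → ℝ => ∑ i, h (x i)) (gaussianPi n) :=
    integrable_finsetSum _ fun i _ => inthx i
  have intQ : Integrable Q (gaussianPi n) := (inthY.const_mul 2).add (intsumh.const_mul 2)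
  have intS : Integrable (fun x : Fin n → ℝ => ∑ m ∈ M,
      132 ^ 2 * L * (min (m : ℝ) (n - m))⁻¹ * (C m).indicator 1 ((V *ᵥ x) j)) (gaussianPi n) :=
    integrable_finsetSum _ fun m _ => (intY (hCm m)).const_mul _
  have i1 := (intY hTm).const_mul (64 * L)
  have i2 := (intInd hB).const_mul (64 * L)
  have i3 := (intInd hB').const_mul (64 * L)
  have intE : Integrable E (gaussianPi n) := (((intS.add i1).add i2).add i3).add intQ
  have hwm : Measurable w := hY.measurable.sub (measurable_rankMatch_apply j)
  refine ⟨(memLp_two_iff_integrable_sq hwm.aestronglyMeasurable).2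
    (intE.mono' (hwm.pow_const 2).aestronglyMeasurable (ae_of_all _ fun x => ?_)), ?_⟩
  · rw [Real.norm_of_nonneg (sq_nonneg _)]
    exact hwE x
  refine (integral_mono_of_nonneg (ae_of_all _ fun x => sq_nonneg (w x)) intE
    (ae_of_all _ hwE)).trans ?_
  have hnn : (n : ℝ) * (1 / n ^ 2) = 1 / n := by field_simp
  have vQ : ∫ x, Q x ∂gaussianPi n ≤ 16 / n := by
    have h1 := valh hY
    have h2 : ∑ i : Fin n, ∫ x, h (x i) ∂gaussianPi n ≤ n * (4 * Real.exp (-2 * L)) := by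
      refine (Finset.sum_le_sum fun i _ => valh (measurePreserving_eval_gaussianPi i)).trans ?_
      simp
    simp only [hQ]
    rw [integral_add (inthY.const_mul 2) (intsumh.const_mul 2), integral_const_mul,
      integral_const_mul, integral_finsetSum _ fun i _ => inthx i]
    have h3 : 16 / (n : ℝ) = 16 * (n * (1 / n ^ 2)) := by rw [hnn]; ring
    rw [h3]
    nlinarith [Real.exp_pos (-2 * L)]
  have vB : (gaussianPi n).real B ≤ 2 / n := by
    refine hBμ.trans ?_
    have h3 : 2 / (n : ℝ) = 2 * (n * (1 / n ^ 2)) := by rw [hnn]; ring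
    rw [h3]
    nlinarith
  have vS : ∫ x : Fin n → ℝ, ∑ m ∈ M, 132 ^ 2 * L * (min (m : ℝ) (n - m))⁻¹ *
      (C m).indicator 1 ((V *ᵥ x) j) ∂gaussianPi n ≤ 132 ^ 2 * L * (2 * L) / n := by
    rw [integral_finsetSum _ fun m _ => (intY (hCm m)).const_mul _]
    simp only [integral_const_mul, valY (hCm _)]
    rw [Finset.sum_congr rfl fun m hm => by rw [hCγ m hm], ← Finset.sum_mul, ← Finset.mul_sum,
      mul_one_div]
    have := sum_inv_depth_le n (K := 484 * L) (by positivity)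
    gcongr
  have hEint := integral_add (((intS.add i1).add i2).add i3) intQ
  rw [integral_add' ((intS.add i1).add i2) i3, integral_add' (intS.add i1) i2,
    integral_add' intS i1] at hEint
  simp only [integral_const_mul] at hEint
  rw [valY hTm, valInd hB, valInd hB', hB'μ] at hEint
  refine hEint.trans_le ?_
  calc _ ≤ 132 ^ 2 * L * (2 * L) / n + 64 * L * (970 * L / n) + 64 * L * (2 / n) +
        64 * L * (2 / n) + 16 / n := by gcongr
    _ = (96928 * L ^ 2 + 256 * L + 16) / n := by ring
    _ ≤ _ := by
      gcongr
      nlinarith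

lemma memLp_eval_gaussianPi {n : ℕ} (i : Fin n) : MemLp (fun x => x i) 2 (gaussianPi n) :=
  (memLp_id_gaussianReal' 2 (by simp)).comp_measurePreserving (measurePreserving_eval_gaussianPi i)

lemma integral_eval_mul_eval_gaussianPi {n : ℕ} (i k : Fin n) :
    ∫ x, x i * x k ∂gaussianPi n = (1 : Matrix (Fin n) (Fin n) ℝ) i k := by
  have h (k : Fin n) {g : ℝ → ℝ} (hg : Continuous g) :
      ∫ x, g (x k) ∂gaussianPi n = ∫ t, g t ∂gaussianReal 0 1 := by
    rw [← (measurePreserving_eval_gaussianPi k).map_eq,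
      integral_map (measurable_pi_apply k).aemeasurable hg.aestronglyMeasurable]
  rcases eq_or_ne i k with rfl | hik
  · rw [one_apply_eq, h i (g := fun t => t * t) (by fun_prop)]
    have hv := variance_id_gaussianReal (μ := 0) (v := 1)
    rw [variance_of_integral_eq_zero aemeasurable_id integral_id_gaussianReal] at hv
    simpa [pow_two] using hv
  · have hind : IndepFun (fun x : Fin n → ℝ => x i) (fun x => x k) (gaussianPi n) :=
      (iIndepFun_pi (μ := fun _ : Fin n => gaussianReal 0 1) (X := fun _ x => x)
        fun _ => aemeasurable_id).indepFun hik
    rw [one_apply_ne hik, hind.integral_fun_mul_eq_mul_integral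
      (memLp_eval_gaussianPi i).aestronglyMeasurable (memLp_eval_gaussianPi k).aestronglyMeasurable,
      h i (g := fun t => t) continuous_id, integral_id_gaussianReal, zero_mul]

lemma integrable_eval_mul_gaussianPi {n : ℕ} {w : (Fin n → ℝ) → ℝ} (hw : MemLp w 2 (gaussianPi n))
    (i : Fin n) : Integrable (fun x => x i * w x) (gaussianPi n) :=
  (memLp_eval_gaussianPi i).integrable_mul hw

/-- Bessel's inequality for the coordinates of a Gaussian vector. -/
lemma sum_sq_integral_eval_mul_le {n : ℕ} {w : (Fin n → ℝ) → ℝ} (hw : MemLp w 2 (gaussianPi n)) :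
    ∑ i, (∫ x, x i * w x ∂gaussianPi n) ^ 2 ≤ ∫ x, w x ^ 2 ∂gaussianPi n := by
  set d : Fin n → ℝ := fun i => ∫ x, x i * w x ∂gaussianPi n with hd
  have hxx (i k : Fin n) : Integrable (fun x => d i * d k * (x i * x k)) (gaussianPi n) :=
    (integrable_eval_mul_gaussianPi (memLp_eval_gaussianPi k) i).const_mul _
  have hxw (i : Fin n) : Integrable (fun x => d i * (x i * w x)) (gaussianPi n) :=
    (integrable_eval_mul_gaussianPi hw i).const_mul _
  have hnonneg : 0 ≤ ∫ x, (w x ^ 2 - 2 * ∑ i, d i * (x i * w x) +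
      ∑ i, ∑ k, d i * d k * (x i * x k)) ∂gaussianPi n := by
    refine integral_nonneg fun x => ?_
    have : w x ^ 2 - 2 * ∑ i, d i * (x i * w x) + ∑ i, ∑ k, d i * d k * (x i * x k) =
        (w x - ∑ i, d i * x i) ^ 2 := by
      simp only [sub_sq, pow_two (∑ i, d i * x i), Finset.sum_mul_sum, ← mul_assoc,
        ← Finset.sum_mul]
      simp only [mul_assoc, mul_left_comm, mul_comm]
    rw [this]
    exact sq_nonneg _
  have h1 : Integrable (fun x => ∑ i, d i * (x i * w x)) (gaussianPi n) :=
    integrable_finsetSum _ fun i _ => hxw i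
  have h2 : Integrable (fun x => ∑ i, ∑ k, d i * d k * (x i * x k)) (gaussianPi n) :=
    integrable_finsetSum _ fun i _ => integrable_finsetSum _ fun k _ => hxx i k
  rw [integral_add (f := fun x => w x ^ 2 - 2 * ∑ i, d i * (x i * w x))
      (hw.integrable_sq.sub (h1.const_mul 2)) h2,
    integral_sub hw.integrable_sq (h1.const_mul 2), integral_const_mul,
    integral_finsetSum _ fun i _ => hxw i,
    integral_finsetSum _ fun i _ => integrable_finsetSum _ fun k _ => hxx i k] at hnonneg
  have h3 : ∑ i, ∫ x, ∑ k, d i * d k * (x i * x k) ∂gaussianPi n = ∑ i, d i ^ 2 := by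
    refine Finset.sum_congr rfl fun i _ => ?_
    rw [integral_finsetSum _ fun k _ => hxx i k]
    simp only [integral_const_mul, integral_eval_mul_eval_gaussianPi]
    simp [one_apply, pow_two]
  have h4 : ∑ i, ∫ x, d i * (x i * w x) ∂gaussianPi n = ∑ i, d i ^ 2 := by
    simp only [integral_const_mul, pow_two]
    rfl
  rw [h3, h4] at hnonneg
  linarith

/-- The second-moment matrix of a Gaussian vector restricted to an event. -/
noncomputable def gaussianSecondMoment {n : ℕ} (S : Set (Fin n → ℝ)) : Matrix (Fin n) (Fin n) ℝ :=
  of fun i k => ∫ x in S, x i * x k ∂gaussianPi n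

lemma posSemidef_gaussianSecondMoment {n : ℕ} (S : Set (Fin n → ℝ)) :
    (gaussianSecondMoment S).PosSemidef := by
  refine .of_dotProduct_mulVec_nonneg ?_ fun v => ?_
  · ext i k
    simp [gaussianSecondMoment, mul_comm]
  · have hfint (i k : Fin n) : Integrable (fun x => v i * (x i * x k * v k))
        ((gaussianPi n).restrict S) :=
      (((integrable_eval_mul_gaussianPi (memLp_eval_gaussianPi k) i).mul_const _).const_mul
        _).integrableOn
    have h : star v ⬝ᵥ (gaussianSecondMoment S *ᵥ v) = ∫ x in S, (v ⬝ᵥ x) ^ 2 ∂gaussianPi n := by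
      have hexp (x : Fin n → ℝ) : (v ⬝ᵥ x) ^ 2 = ∑ i, ∑ k, v i * (x i * x k * v k) := by
        simp only [dotProduct, pow_two, Finset.sum_mul_sum]
        exact Finset.sum_congr rfl fun i _ => Finset.sum_congr rfl fun k _ => by ring
      simp only [hexp]
      rw [integral_finsetSum _ fun i _ => integrable_finsetSum _ fun k _ => hfint i k]
      refine Finset.sum_congr rfl fun i _ => ?_
      rw [integral_finsetSum _ fun k _ => hfint i k]
      simp [gaussianSecondMoment, mulVec, dotProduct, Finset.mul_sum, integral_const_mul,
        integral_mul_const]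
    rw [h]
    exact integral_nonneg fun x => sq_nonneg _

/-- Splitting an integral according to the value of a finite-valued map. -/
lemma sum_setIntegral_fiber {α β : Type*} [MeasurableSpace α] {μ : Measure α} [Fintype β]
    {p : α → β} (hp : ∀ b, MeasurableSet {a | p a = b}) {f : β → α → ℝ}
    (hf : ∀ b, Integrable (f b) μ) :
    ∑ b, ∫ a in {a | p a = b}, f b a ∂μ = ∫ a, f (p a) a ∂μ := by
  classical
  simp only [← integral_indicator (hp _)]
  rw [← integral_finsetSum _ fun b _ => (hf b).indicator (hp b)]
  simp [Set.indicator_apply]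

/-- An orthogonal matrix minus the permutation sum obtained by rank matching. -/
lemma sub_sum_gaussianSecondMoment_apply {n : ℕ} {V : Matrix (Fin n) (Fin n) ℝ} (hV : Vᵀ * V = 1)
    (i j : Fin n) :
    (Vᵀ - ∑ σ : Equiv.Perm (Fin n), gaussianSecondMoment {x | (rankMatch x (V *ᵥ x)).symm = σ} *
        σ.permMatrix ℝ) i j =
      ∫ x, x i * ((V *ᵥ x) j - x (rankMatch x (V *ᵥ x) j)) ∂gaussianPi n := by
  have hVm : Measurable fun x : Fin n → ℝ => V *ᵥ x :=
    (Continuous.matrix_mulVec continuous_const continuous_id).measurable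
  have hVx (k : Fin n) : Integrable (fun x => V j k * (x i * x k)) (gaussianPi n) :=
    (integrable_eval_mul_gaussianPi (memLp_eval_gaussianPi k) i).const_mul _
  have hexp (x : Fin n → ℝ) : x i * (V *ᵥ x) j = ∑ k, V j k * (x i * x k) := by
    simp only [mulVec, dotProduct, Finset.mul_sum]
    exact Finset.sum_congr rfl fun k _ => by ring
  have h1 : Integrable (fun x => x i * (V *ᵥ x) j) (gaussianPi n) := by
    simp only [hexp]
    exact integrable_finsetSum _ fun k _ => hVx k
  have h2 : ∫ x, x i * (V *ᵥ x) j ∂gaussianPi n = V j i := by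
    simp only [hexp]
    rw [integral_finsetSum _ fun k _ => hVx k]
    simp only [integral_const_mul, integral_eval_mul_eval_gaussianPi]
    simp [one_apply]
  have h3 := integrable_eval_mul_gaussianPi (integral_sq_sub_rankMatch_le hV j).1 i
  have h4 : Integrable (fun x => x i * x (rankMatch x (V *ᵥ x) j)) (gaussianPi n) := by
    refine (h1.sub h3).congr (ae_of_all _ fun x => ?_)
    simp only [Pi.sub_apply]
    ring
  simp only [mul_sub]
  rw [integral_sub h1 h4, h2, Matrix.sub_apply, Matrix.sum_apply, transpose_apply]
  congr 1
  have h5 := sum_setIntegral_fiber (μ := gaussianPi n)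
    (p := fun x => (rankMatch x (V *ᵥ x)).symm) (f := fun σ x => x i * x (σ.symm j))
    (measurableSet_rankMatch_eq hVm measurable_id)
    fun σ => integrable_eval_mul_gaussianPi (memLp_eval_gaussianPi (σ.symm j)) i
  simp only [Equiv.symm_symm] at h5
  rw [← h5]
  refine Finset.sum_congr rfl fun σ _ => ?_
  rw [Equiv.Perm.permMatrix, PEquiv.mul_toMatrix_toPEquiv]
  rfl

end

theorem stmt15 :
    ∃ c : ℝ, 0 < c ∧ ∀ (n : ℕ), 2 ≤ n →
      ∀ U : Matrix (Fin n) (Fin n) ℝ, U * Uᵀ = 1 →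
      ∃ A : Equiv.Perm (Fin n) → Matrix (Fin n) (Fin n) ℝ,
        (∀ σ, (A σ).PosSemidef) ∧
        (∑ σ : Equiv.Perm (Fin n), A σ) = 1 ∧
        (∀ i j, |(U - ∑ σ : Equiv.Perm (Fin n), A σ * σ.permMatrix ℝ) i j| ≤
            c * Real.log n / Real.sqrt n) ∧
        Real.sqrt (∑ i, ∑ j,
            ((U - ∑ σ : Equiv.Perm (Fin n), A σ * σ.permMatrix ℝ) i j) ^ 2) ≤
          c * Real.log n := by
  refine ⟨1000, by norm_num, fun n hn U hU => ?_⟩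
  have hV : Uᵀᵀ * Uᵀ = 1 := by rwa [transpose_transpose]
  have hVm : Measurable fun x : Fin n → ℝ => Uᵀ *ᵥ x :=
    (Continuous.matrix_mulVec continuous_const continuous_id).measurable
  have hn0 : (0 : ℝ) < n := by positivity
  have hlog : 0.69 < Real.log n :=
    lt_of_lt_of_le (by linarith [Real.log_two_gt_d9])
      (Real.log_le_log two_pos (by exact_mod_cast hn))
  have hcol (j : Fin n) : ∑ i, ((U - ∑ σ : Equiv.Perm (Fin n), gaussianSecondMoment
      {x | (rankMatch x (Uᵀ *ᵥ x)).symm = σ} * σ.permMatrix ℝ) i j) ^ 2 ≤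
        (1000 * Real.log n) ^ 2 / n := by
    have h := sub_sum_gaussianSecondMoment_apply hV
    rw [transpose_transpose] at h
    simp only [h]
    obtain ⟨hw, hle⟩ := integral_sq_sub_rankMatch_le hV j
    refine (sum_sq_integral_eval_mul_le hw).trans (hle.trans ?_)
    gcongr
    nlinarith
  refine ⟨fun σ => gaussianSecondMoment {x | (rankMatch x (Uᵀ *ᵥ x)).symm = σ},
    fun σ => posSemidef_gaussianSecondMoment _, ?_, fun i j => ?_, ?_⟩
  · ext i k
    rw [Matrix.sum_apply, ← integral_eval_mul_eval_gaussianPi]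
    exact sum_setIntegral_fiber (measurableSet_rankMatch_eq hVm measurable_id)
      (f := fun _ x => x i * x k)
      fun σ => integrable_eval_mul_gaussianPi (memLp_eval_gaussianPi k) i
  · refine abs_le_of_sq_le_sq ?_ (by positivity)
    rw [div_pow, Real.sq_sqrt hn0.le]
    exact (Finset.single_le_sum (f := fun i => ((U - ∑ σ : Equiv.Perm (Fin n),
      gaussianSecondMoment {x | (rankMatch x (Uᵀ *ᵥ x)).symm = σ} * σ.permMatrix ℝ) i j) ^ 2)
      (fun i _ => sq_nonneg _) (Finset.mem_univ i)).trans (hcol j)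
  · refine Real.sqrt_le_iff.2 ⟨by positivity, ?_⟩
    rw [Finset.sum_comm]
    refine (Finset.sum_le_sum fun j _ => hcol j).trans_eq ?_
    rw [Finset.sum_const, Finset.card_univ, Fintype.card_fin, nsmul_eq_mul]
    field_simp
end
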